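/- Let n > 10 be an integer, p > p_c and α > 0. Suppose v₀ : [0,∞) → ℝ is continuous with 0 ≤ v₀(r) ≤ L r^{−ν} for all r > 0, φ_α(r) ≤ v₀(r) for all r ≥ 0, and v₀(r) ≤ φ_α(r) + b r^{−γ} for all r > 1, with some b > 0 and γ ∈ (ν+λ₁, (n−2)/2). Then there exists C > 0 such that every bounded classical radial solution v of (v^p)_t = v_rr + ((n−1)/r)v_r + v^p with initial data v₀ satisfies |v(r,t) − φ_α(r)| ≤ C e^{−κ(γ) t} for all r ≥ 0 and t ≥ 0, where κ(γ) := γ(n−2−γ)/(pL^{p−1}) − 1. -/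

import Mathlib

noncomputable section

open Real Filter Set Asymptotics

/-- `ν = 2/(p-1)`. -/
def nuExp (p : ℝ) : ℝ := 2 / (p - 1)

/-- `L = (ν(n−2−ν))^{1/(p−1)}`. -/
def Lconst (n : ℕ) (p : ℝ) : ℝ := (nuExp p * ((n : ℝ) - 2 - nuExp p)) ^ (1 / (p - 1))

/-- The critical exponent `p_c` for `n > 10`. -/
def pc (n : ℕ) : ℝ :=
  (((n : ℝ) - 2) ^ 2 - 4 * (n : ℝ) + 8 * Real.sqrt ((n : ℝ) - 1)) /
    (((n : ℝ) - 2) * ((n : ℝ) - 10))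

/-- `λ₁ = (n−2−2ν − √((n−2−2ν)² − 8(n−2−ν)))/2`. -/
def lam1 (n : ℕ) (p : ℝ) : ℝ :=
  (((n : ℝ) - 2 - 2 * nuExp p) -
    Real.sqrt (((n : ℝ) - 2 - 2 * nuExp p) ^ 2 - 8 * ((n : ℝ) - 2 - nuExp p))) / 2

/-- `κ(γ) = γ(n−2−γ)/(pL^{p−1}) − 1`. -/
def kappaOf (n : ℕ) (p γ : ℝ) : ℝ :=
  γ * ((n : ℝ) - 2 - γ) / (p * Lconst n p ^ (p - 1)) - 1

/-- `φ` is the (radial profile of the) positive steady state `φ_α` of `Δφ + φ^p = 0`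
with `φ(0) = α`, `φ'(0) = 0`, together with its properties in the supercritical range
`n > 10`, `p > p_c`: positivity, strict monotonicity, the bound `φ(r) ≤ L r^{−ν}`, and the
asymptotic expansion `φ(r) = L r^{−ν} − a r^{−ν−λ₁} + o(r^{−ν−λ₁})` with coefficient `a > 0`. -/
structure IsSteadyStateA (n : ℕ) (p α : ℝ) (φ : ℝ → ℝ) (a : ℝ) : Prop where
  cont : ContinuousOn φ (Set.Ici 0)
  smooth : ContDiffOn ℝ 2 φ (Set.Ioi 0)
  ode : ∀ r > (0 : ℝ), deriv (deriv φ) r + ((n : ℝ) - 1) / r * deriv φ r + φ r ^ p = 0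
  val0 : φ 0 = α
  deriv0 : derivWithin φ (Set.Ici 0) 0 = 0
  pos : ∀ r ≥ (0 : ℝ), 0 < φ r
  anti : StrictAntiOn φ (Set.Ici 0)
  upper : ∀ r > (0 : ℝ), φ r ≤ Lconst n p * r ^ (-nuExp p)
  a_pos : 0 < a
  expansion :
    (fun r => φ r - (Lconst n p * r ^ (-nuExp p) - a * r ^ (-nuExp p - lam1 n p)))
      =o[atTop] fun r => r ^ (-nuExp p - lam1 n p)

/-- `v` is a bounded classical radial solution of
`(v^p)_t = v_rr + ((n−1)/r) v_r + v^p` with initial data `v₀ : [0,∞) → ℝ`: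
nonnegative and continuous on `[0,∞) × [0,∞)`, bounded on `[0,∞) × [0,T]` for every
`T > 0`, `C²` in `r` and `C¹` in `t` for `t > 0` with `∂_r v(0,t) = 0`, satisfying the
equation pointwise for `r > 0`, `t > 0`, and attaining the initial data. -/
structure IsRadialSol (n : ℕ) (p : ℝ) (v : ℝ → ℝ → ℝ) (v₀ : ℝ → ℝ) : Prop where
  nonneg : ∀ r ≥ (0 : ℝ), ∀ t ≥ (0 : ℝ), 0 ≤ v r t
  cont : ContinuousOn (fun q : ℝ × ℝ => v q.1 q.2) (Set.Ici 0 ×ˢ Set.Ici 0)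
  bdd : ∀ T > (0 : ℝ), ∃ M, ∀ r ≥ (0 : ℝ), ∀ t ∈ Set.Icc (0 : ℝ) T, v r t ≤ M
  smooth_r : ∀ t > (0 : ℝ), ContDiffOn ℝ 2 (fun r => v r t) (Set.Ici 0)
  smooth_t : ∀ r ≥ (0 : ℝ), ContDiffOn ℝ 1 (fun s => v r s ^ p) (Set.Ioi (0 : ℝ))
  slope0 : ∀ t > (0 : ℝ), derivWithin (fun r => v r t) (Set.Ici 0) 0 = 0
  pde : ∀ r > (0 : ℝ), ∀ t > (0 : ℝ),
    deriv (fun s => v r s ^ p) t =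
      deriv (deriv fun ρ => v ρ t) r + ((n : ℝ) - 1) / r * deriv (fun ρ => v ρ t) r
        + v r t ^ p
  init : ∀ r ≥ (0 : ℝ), v r 0 = v₀ r

theorem rr_touch (G : ℝ → ℝ → ℝ) (ρ R t0 T : ℝ)
    (cont : ContinuousOn (fun q : ℝ × ℝ => G q.1 q.2) (Icc ρ R ×ˢ Icc t0 T))
    (bottom : ∀ r ∈ Icc ρ R, 0 < G r t0)
    (left : ∀ t ∈ Icc t0 T, 0 < G ρ t) (right : ∀ t ∈ Icc t0 T, 0 < G R t)
    (r₁ t₁ : ℝ) (hr₁ : r₁ ∈ Icc ρ R) (ht₁ : t₁ ∈ Icc t0 T) (hneg : G r₁ t₁ ≤ 0) :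
    ∃ r ∈ Ioo ρ R, ∃ t ∈ Ioc t0 T, G r t = 0 ∧ (∀ x ∈ Icc ρ R, 0 ≤ G x t) ∧
      (∀ s ∈ Ico t0 t, 0 < G r s) := by
  set K : Set (ℝ × ℝ) := Icc ρ R ×ˢ Icc t0 T with hK
  have hKc : IsCompact K := isCompact_Icc.prod isCompact_Icc
  have hS : IsCompact (K ∩ (fun q : ℝ × ℝ => G q.1 q.2) ⁻¹' Iic 0) := by
    apply hKc.of_isClosed_subset _ inter_subset_left
    exact cont.preimage_isClosed_of_isClosed hKc.isClosed isClosed_Iic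
  obtain ⟨⟨r, t⟩, ⟨⟨hr, ht⟩, hG⟩, hmin⟩ := hS.exists_isMinOn
    ⟨(r₁, t₁), ⟨hr₁, ht₁⟩, hneg⟩ (f := fun q => q.2) continuous_snd.continuousOn
  simp only [mem_preimage, mem_Iic] at hG hr ht
  have hpos : ∀ x ∈ Icc ρ R, ∀ s ∈ Ico t0 t, 0 < G x s := by
    intro x hx s hs
    by_contra hcon
    push Not at hcon
    have : t ≤ s := hmin (a := (x, s)) ⟨⟨hx, hs.1, hs.2.le.trans ht.2⟩, hcon⟩
    exact absurd hs.2 (not_lt.mpr this)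
  have ht0 : t0 < t := by
    rcases ht.1.lt_or_eq with h | h
    · exact h
    · rw [← h] at hG; exact absurd (bottom r hr) (not_lt.mpr hG)
  have hnn : ∀ x ∈ Icc ρ R, 0 ≤ G x t := by
    intro x hx
    have hc : ContinuousOn (fun s => G x s) (Icc t0 T) := by
      have : ContinuousOn (fun s : ℝ => ((x, s) : ℝ × ℝ)) (Icc t0 T) := by fun_prop
      exact cont.comp this (fun s hs => ⟨hx, hs⟩)
    have h1 : Tendsto (fun s => G x s) (nhdsWithin t (Ico t0 t)) (nhds (G x t)) :=
      (hc t ht).mono_left (nhdsWithin_mono _ (fun s hs => ⟨hs.1, hs.2.le.trans ht.2⟩))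
    have : (nhdsWithin t (Ico t0 t)).NeBot := by
      rw [← mem_closure_iff_nhdsWithin_neBot, closure_Ico ht0.ne]
      exact ⟨ht0.le, le_rfl⟩
    apply ge_of_tendsto h1
    filter_upwards [self_mem_nhdsWithin] with s hs using (hpos x hx s hs).le
  have hG0 : G r t = 0 := le_antisymm hG (hnn r hr)
  refine ⟨r, ⟨?_, ?_⟩, t, ⟨ht0, ht.2⟩, hG0, hnn, fun s hs => hpos r hr s hs⟩
  · rcases hr.1.lt_or_eq with h | h
    · exact h
    · have := left t ht; rw [h] at this; linarith
  · rcases hr.2.lt_or_eq with h | h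
    · exact h
    · have := right t ht; rw [← h] at this; linarith

theorem rr_second (f f1 : ℝ → ℝ) (f2 r : ℝ) (h1 : ∀ᶠ x in nhds r, HasDerivAt f (f1 x) x)
    (h2 : HasDerivAt f1 f2 r) (hm : IsLocalMin f r) : f1 r = 0 ∧ 0 ≤ f2 := by
  have hd : deriv f =ᶠ[nhds r] f1 := h1.mono (fun x hx => hx.deriv)
  have h10 : f1 r = 0 := hm.hasDerivAt_eq_zero h1.self_of_nhds
  refine ⟨h10, ?_⟩
  by_contra hcon
  push Not at hcon
  have hdd : deriv (deriv f) r = f2 := by rw [hd.deriv_eq]; exact h2.deriv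
  have hmax : IsLocalMax f r := isLocalMax_of_deriv_deriv_neg (by rw [hdd]; exact hcon)
    (by rw [hd.self_of_nhds]; exact h10) h1.self_of_nhds.continuousAt
  have hconst : f =ᶠ[nhds r] fun _ => f r := by
    filter_upwards [hm, hmax] with x a b using le_antisymm b a
  have : deriv f =ᶠ[nhds r] fun _ => 0 := by
    have := hconst.deriv
    simpa using this
  have : deriv (deriv f) r = 0 := by rw [this.deriv_eq]; simp
  linarith

theorem rr_leftderiv (f : ℝ → ℝ) (f' t0 t : ℝ) (h : HasDerivAt f f' t) (h0 : f t = 0)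
    (htt : t0 < t) (hpos : ∀ s ∈ Ico t0 t, 0 ≤ f s) : f' ≤ 0 := by
  have h1 := (hasDerivAt_iff_tendsto_slope.1 h).mono_left
    (nhdsWithin_mono t (fun s (hs : s ∈ Iio t) => (ne_of_lt hs : s ≠ t)))
  apply le_of_tendsto h1
  have : Ioo t0 t ∈ nhdsWithin t (Iio t) := Ioo_mem_nhdsLT htt
  filter_upwards [this] with s hs
  rw [slope_def_field, h0, sub_zero]
  exact div_nonpos_of_nonneg_of_nonpos (hpos s ⟨hs.1.le, hs.2⟩) (by linarith [hs.2])

/-- `f1`, `f2` are the first two derivatives of `f` on `(0,∞)`. -/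
def RRC2 (f f1 f2 : ℝ → ℝ) : Prop :=
  ∀ r > (0:ℝ), HasDerivAt f (f1 r) r ∧ HasDerivAt f1 (f2 r) r

theorem rr_v_c2 {n : ℕ} {p : ℝ} {v : ℝ → ℝ → ℝ} {v₀ : ℝ → ℝ} (hv : IsRadialSol n p v v₀)
    {t : ℝ} (ht : 0 < t) :
    RRC2 (fun r => v r t) (deriv fun ρ => v ρ t) (deriv (deriv fun ρ => v ρ t)) := by
  intro r hr
  have h := (hv.smooth_r t ht).mono (Ioi_subset_Ici_self)
  have h1 := (contDiffOn_succ_iff_deriv_of_isOpen (n := 1) isOpen_Ioi).1 (by rw [one_add_one_eq_two]; exact h)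
  refine ⟨(h1.1.differentiableAt (Ioi_mem_nhds hr)).hasDerivAt, ?_⟩
  exact ((h1.2.2.differentiableOn (by norm_num)).differentiableAt (Ioi_mem_nhds hr)).hasDerivAt

theorem rr_v_t {n : ℕ} {p : ℝ} {v : ℝ → ℝ → ℝ} {v₀ : ℝ → ℝ} (hv : IsRadialSol n p v v₀)
    {r t : ℝ} (hr : 0 ≤ r) (ht : 0 < t) :
    HasDerivAt (fun s => v r s ^ p) (deriv (fun s => v r s ^ p) t) t :=
  (((hv.smooth_t r hr).differentiableOn (by norm_num)).differentiableAt
    (Ioi_mem_nhds ht)).hasDerivAt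

theorem rr_upper {n : ℕ} {p : ℝ} (hp : 1 < p) {v : ℝ → ℝ → ℝ} {v₀ : ℝ → ℝ}
    (hv : IsRadialSol n p v v₀) (V V1 V2 Vt : ℝ → ℝ → ℝ) (ρ R t0 T : ℝ) (hρ : 0 < ρ)
    (ht0 : 0 ≤ t0)
    (cont : ContinuousOn (fun q : ℝ × ℝ => V q.1 q.2) (Icc ρ R ×ˢ Icc t0 T))
    (hc2 : ∀ t > 0, RRC2 (fun r => V r t) (fun r => V1 r t) (fun r => V2 r t))
    (hct : ∀ r > 0, ∀ t > 0, HasDerivAt (fun s => V r s) (Vt r t) t)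
    (bottom : ∀ r ∈ Icc ρ R, v r t0 < V r t0)
    (left : ∀ t ∈ Icc t0 T, v ρ t < V ρ t) (right : ∀ t ∈ Icc t0 T, v R t < V R t)
    (key : ∀ r ∈ Ioo ρ R, ∀ t ∈ Ioc t0 T, v r t = V r t →
      V2 r t + ((n:ℝ) - 1) / r * V1 r t + V r t ^ p < p * V r t ^ (p - 1) * Vt r t) :
    ∀ r ∈ Icc ρ R, ∀ t ∈ Icc t0 T, v r t < V r t := by
  intro r₁ hr₁ t₁ ht₁
  by_contra hcon
  push Not at hcon
  have hvc : ContinuousOn (fun q : ℝ × ℝ => v q.1 q.2) (Icc ρ R ×ˢ Icc t0 T) :=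
    hv.cont.mono (prod_mono (fun x hx => hρ.le.trans hx.1) (fun x hx => ht0.trans hx.1))
  obtain ⟨r, hr, t, ht, h0, hx, hs⟩ := rr_touch (fun r t => V r t - v r t) ρ R t0 T
    (cont.sub hvc) (fun r hr => sub_pos.2 (bottom r hr)) (fun r hr => sub_pos.2 (left r hr))
    (fun r hr => sub_pos.2 (right r hr)) r₁ t₁ hr₁ ht₁ (by linarith)
  have hr0 : 0 < r := hρ.trans hr.1
  have htp : 0 < t := ht0.trans_lt ht.1
  have hvV : v r t = V r t := by linarith
  have hk := key r hr t ht hvV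
  have hmin : IsLocalMin (fun x => V x t - v x t) r := by
    filter_upwards [Icc_mem_nhds hr.1 hr.2] with x hxx
    rw [h0]; exact hx x hxx
  have hsec := rr_second (fun x => V x t - v x t)
    (fun x => V1 x t - deriv (fun ρ => v ρ t) x) (V2 r t - deriv (deriv fun ρ => v ρ t) r) r
    (by
      filter_upwards [Ioi_mem_nhds hr0] with x hx
      exact (hc2 t htp x hx).1.sub (rr_v_c2 hv htp x hx).1)
    ((hc2 t htp r hr0).2.sub (rr_v_c2 hv htp r hr0).2) hmin
  have htd := rr_leftderiv (fun s => V r s ^ p - v r s ^ p)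
    (Vt r t * p * V r t ^ (p - 1) - deriv (fun s => v r s ^ p) t) t0 t
    (((hct r hr0 t htp).rpow_const (Or.inr hp.le)).sub (rr_v_t hv hr0.le htp))
    (by simp [hvV]) ht.1 (by
      intro s hss
      have := hs s hss
      have h2 := hv.nonneg r hr0.le s (ht0.trans hss.1)
      exact sub_nonneg.2 (rpow_le_rpow h2 (by linarith) (by linarith)))
  have hpde := hv.pde r hr0 t htp
  have e1 : V1 r t = deriv (fun ρ => v ρ t) r := by linarith [hsec.1]
  rw [hvV, ← e1] at hpde
  nlinarith [hsec.2]

theorem rr_lower {n : ℕ} {p : ℝ} (hp : 1 < p) {v : ℝ → ℝ → ℝ} {v₀ : ℝ → ℝ}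
    (hv : IsRadialSol n p v v₀) (V V1 V2 Vt : ℝ → ℝ → ℝ) (ρ R t0 T : ℝ) (hρ : 0 < ρ)
    (ht0 : 0 ≤ t0)
    (cont : ContinuousOn (fun q : ℝ × ℝ => V q.1 q.2) (Icc ρ R ×ˢ Icc t0 T))
    (hc2 : ∀ t > 0, RRC2 (fun r => V r t) (fun r => V1 r t) (fun r => V2 r t))
    (hct : ∀ r > 0, ∀ t > 0, HasDerivAt (fun s => V r s) (Vt r t) t)
    (anti : ∀ r > 0, ∀ s t, s ≤ t → V r t ≤ V r s)
    (bottom : ∀ r ∈ Icc ρ R, V r t0 < v r t0)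
    (left : ∀ t ∈ Icc t0 T, V ρ t < v ρ t) (right : ∀ t ∈ Icc t0 T, V R t < v R t)
    (key : ∀ r ∈ Ioo ρ R, ∀ t ∈ Ioc t0 T, 0 ≤ V r t →
      p * V r t ^ (p - 1) * Vt r t < V2 r t + ((n:ℝ) - 1) / r * V1 r t + V r t ^ p) :
    ∀ r ∈ Icc ρ R, ∀ t ∈ Icc t0 T, V r t < v r t := by
  intro r₁ hr₁ t₁ ht₁
  by_contra hcon
  push Not at hcon
  have hvc : ContinuousOn (fun q : ℝ × ℝ => v q.1 q.2) (Icc ρ R ×ˢ Icc t0 T) :=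
    hv.cont.mono (prod_mono (fun x hx => hρ.le.trans hx.1) (fun x hx => ht0.trans hx.1))
  obtain ⟨r, hr, t, ht, h0, hx, hs⟩ := rr_touch (fun r t => v r t - V r t) ρ R t0 T
    (hvc.sub cont) (fun r hr => sub_pos.2 (bottom r hr)) (fun r hr => sub_pos.2 (left r hr))
    (fun r hr => sub_pos.2 (right r hr)) r₁ t₁ hr₁ ht₁ (by linarith)
  have hr0 : 0 < r := hρ.trans hr.1
  have htp : 0 < t := ht0.trans_lt ht.1
  have hvV : v r t = V r t := by linarith
  have hV0 : 0 ≤ V r t := hvV ▸ hv.nonneg r hr0.le t htp.le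
  have hk := key r hr t ht hV0
  have hmin : IsLocalMin (fun x => v x t - V x t) r := by
    filter_upwards [Icc_mem_nhds hr.1 hr.2] with x hxx
    rw [h0]; exact hx x hxx
  have hsec := rr_second (fun x => v x t - V x t)
    (fun x => deriv (fun ρ => v ρ t) x - V1 x t) (deriv (deriv fun ρ => v ρ t) r - V2 r t) r
    (by
      filter_upwards [Ioi_mem_nhds hr0] with x hx
      exact (rr_v_c2 hv htp x hx).1.sub (hc2 t htp x hx).1)
    ((rr_v_c2 hv htp r hr0).2.sub (hc2 t htp r hr0).2) hmin
  have htd := rr_leftderiv (fun s => v r s ^ p - V r s ^ p)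
    (deriv (fun s => v r s ^ p) t - Vt r t * p * V r t ^ (p - 1)) t0 t
    ((rr_v_t hv hr0.le htp).sub ((hct r hr0 t htp).rpow_const (Or.inr hp.le)))
    (by simp [hvV]) ht.1 (by
      intro s hss
      have := hs s hss
      have h2 := anti r hr0 s t hss.2.le
      exact sub_nonneg.2 (rpow_le_rpow (hV0.trans h2) (by linarith) (by linarith)))
  have hpde := hv.pde r hr0 t htp
  have e1 : deriv (fun ρ => v ρ t) r = V1 r t := by linarith [hsec.1]
  rw [hvV, e1] at hpde
  nlinarith [hsec.2]

/-- Upper comparison for barriers `f + c e^{at} g + ε e^{bt} h`. -/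
theorem rr_upper3 {n : ℕ} {p : ℝ} (hp : 1 < p) {v : ℝ → ℝ → ℝ} {v₀ : ℝ → ℝ}
    (hv : IsRadialSol n p v v₀) {f f1 f2 g g1 g2 h h1 h2 : ℝ → ℝ} (c a ε b : ℝ)
    (hf : RRC2 f f1 f2) (hg : RRC2 g g1 g2) (hh : RRC2 h h1 h2)
    (ρ R t0 T : ℝ) (hρ : 0 < ρ) (ht0 : 0 ≤ t0)
    (bottom : ∀ r ∈ Icc ρ R, v r t0 < f r + c * exp (a * t0) * g r + ε * exp (b * t0) * h r)
    (left : ∀ t ∈ Icc t0 T, v ρ t < f ρ + c * exp (a * t) * g ρ + ε * exp (b * t) * h ρ)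
    (right : ∀ t ∈ Icc t0 T, v R t < f R + c * exp (a * t) * g R + ε * exp (b * t) * h R)
    (key : ∀ r ∈ Ioo ρ R, ∀ t ∈ Ioc t0 T,
      v r t = f r + c * exp (a * t) * g r + ε * exp (b * t) * h r →
      (f2 r + ((n:ℝ) - 1) / r * f1 r) + c * exp (a * t) * (g2 r + ((n:ℝ) - 1) / r * g1 r)
        + ε * exp (b * t) * (h2 r + ((n:ℝ) - 1) / r * h1 r) + v r t ^ p
        < p * v r t ^ (p - 1) * (a * (c * exp (a * t) * g r) + b * (ε * exp (b * t) * h r))) :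
    ∀ r ∈ Icc ρ R, ∀ t ∈ Icc t0 T,
      v r t < f r + c * exp (a * t) * g r + ε * exp (b * t) * h r := by
  have hcon : ∀ {f f1 f2 : ℝ → ℝ}, RRC2 f f1 f2 →
      ContinuousOn (fun q : ℝ × ℝ => f q.1) (Icc ρ R ×ˢ Icc t0 T) := by
    intro f f1 f2 hf
    have h1 : ContinuousOn f (Icc ρ R) := fun x hx =>
      ((hf x (hρ.trans_le hx.1)).1.continuousAt).continuousWithinAt
    exact h1.comp continuousOn_fst (fun q hq => hq.1)
  have hexp : ∀ a : ℝ, ∀ t : ℝ, HasDerivAt (fun s => exp (a * s)) (a * exp (a * t)) t := by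
    intro a t
    have := ((hasDerivAt_id t).const_mul a).exp
    simpa [mul_comm] using this
  refine rr_upper hp hv (fun r t => f r + c * exp (a * t) * g r + ε * exp (b * t) * h r)
    (fun r t => f1 r + c * exp (a * t) * g1 r + ε * exp (b * t) * h1 r)
    (fun r t => f2 r + c * exp (a * t) * g2 r + ε * exp (b * t) * h2 r)
    (fun r t => a * (c * exp (a * t) * g r) + b * (ε * exp (b * t) * h r))
    ρ R t0 T hρ ht0 ?_ ?_ ?_ bottom left right ?_
  · refine ((hcon hf).add (ContinuousOn.mul ?_ (hcon hg))).add (ContinuousOn.mul ?_ (hcon hh))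
    · exact Continuous.continuousOn (by fun_prop)
    · exact Continuous.continuousOn (by fun_prop)
  · intro t ht r hr
    exact ⟨((hf r hr).1.add ((hg r hr).1.const_mul _)).add ((hh r hr).1.const_mul _),
      ((hf r hr).2.add ((hg r hr).2.const_mul _)).add ((hh r hr).2.const_mul _)⟩
  · intro r hr t ht
    have := ((((hexp a t).const_mul c).mul_const (g r)).const_add (f r)).add
      (((hexp b t).const_mul ε).mul_const (h r))
    exact this.congr_deriv (by ring)
  · intro r hr t ht hvV
    have := key r hr t ht hvV
    rw [← hvV]
    refine lt_of_eq_of_lt ?_ this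
    ring

structure RRPar (n : ℕ) (p ν L : ℝ) : Prop where
  hp : 1 < p
  hn : (11:ℝ) ≤ n
  ν_pos : 0 < ν
  νp : ν * (p - 1) = 2
  ν_lt : ν < ((n:ℝ) - 2) / 2
  L_pos : 0 < L
  Lp : L ^ (p - 1) = ν * ((n:ℝ) - 2 - ν)

theorem rr_c2_rpow (c a : ℝ) : RRC2 (fun r => c * r ^ a) (fun r => c * a * r ^ (a - 1))
    (fun r => c * a * (a - 1) * r ^ (a - 2)) := by
  intro r hr
  refine ⟨?_, ?_⟩
  · exact ((hasDerivAt_rpow_const (p := a) (Or.inl hr.ne')).const_mul c).congr_deriv (by ring)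
  · have := (hasDerivAt_rpow_const (x := r) (p := a - 1) (Or.inl hr.ne')).const_mul (c * a)
    refine this.congr_deriv ?_
    rw [show a - 1 - 1 = a - 2 by ring]; ring

theorem rr_c2_const (c : ℝ) : RRC2 (fun _ => c) (fun _ => 0) (fun _ => 0) :=
  fun r _ => ⟨hasDerivAt_const r c, hasDerivAt_const r 0⟩

theorem rr_lap (q c a r : ℝ) (hr : 0 < r) :
    c * a * (a - 1) * r ^ (a - 2) + (q - 1) / r * (c * a * r ^ (a - 1))
      = c * a * (a + q - 2) * r ^ (a - 2) := by
  have : r ^ (a - 1) = r ^ (a - 2) * r := by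
    rw [← rpow_add_one hr.ne']; congr 1; ring
  rw [this]; field_simp; ring

theorem rr_conv {p x y : ℝ} (hp : 1 < p) (hy : 0 ≤ y) (hxy : y ≤ x) :
    x ^ p - y ^ p ≤ p * x ^ (p - 1) * (x - y) := by
  rcases (hy.trans hxy).eq_or_lt with h | h
  · have : y = 0 := by linarith
    rw [← h, this]; simp
  have h1 := one_add_mul_self_le_rpow_one_add (s := y / x - 1)
    (by have : 0 ≤ y / x := div_nonneg hy h.le
        linarith) hp.le
  rw [show 1 + (y / x - 1) = y / x by ring, div_rpow hy h.le, le_div_iff₀ (rpow_pos_of_pos h p)]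
    at h1
  have h2 : x ^ p = x ^ (p - 1) * x := by rw [← rpow_add_one h.ne']; congr 1; ring
  have h3 : (1 + p * (y / x - 1)) * x ^ p = x ^ p - p * x ^ (p - 1) * (x - y) := by
    rw [h2]; field_simp; ring
  linarith

theorem rr_eps {x y C : ℝ} (hC : 0 < C) (h : ∀ ε > 0, x < y + ε * C) : x ≤ y := by
  apply le_of_forall_pos_le_add
  intro e he
  have := h (e / C) (div_pos he hC)
  rw [div_mul_cancel₀ _ hC.ne'] at this
  exact this.le

theorem rr_near0 {a c : ℝ} (ha : 0 < a) (hc : 0 < c) (M r₁ : ℝ) (hr : 0 < r₁) :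
    ∃ ρ, 0 < ρ ∧ ρ ≤ r₁ ∧ M < c * ρ ^ (-a) := by
  have h1 := (tendsto_rpow_atTop ha).const_mul_atTop hc
  obtain ⟨x, hx1, hx2⟩ := ((h1.eventually_gt_atTop M).and
    (eventually_ge_atTop (max 1 (1 / r₁)))).exists
  have hx0 : 0 < x := lt_of_lt_of_le one_pos ((le_max_left _ _).trans hx2)
  refine ⟨x⁻¹, inv_pos.2 hx0, ?_, ?_⟩
  · rw [inv_le_comm₀ hx0 hr, ← one_div]; exact (le_max_right _ _).trans hx2
  · rw [rpow_neg (inv_pos.2 hx0).le, inv_rpow hx0.le, inv_inv]; exact hx1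

theorem rr_far {a : ℝ} (ha : 0 < a) (c ε r₁ : ℝ) (hε : 0 < ε) :
    ∃ R, r₁ ≤ R ∧ 0 < R ∧ c * R ^ (-a) < ε := by
  have h1 := (tendsto_rpow_neg_atTop ha).const_mul c
  rw [mul_zero] at h1
  obtain ⟨x, hx1, hx2⟩ := ((h1.eventually_lt_const hε).and
    (eventually_ge_atTop (max 1 r₁))).exists
  exact ⟨x, (le_max_right _ _).trans hx2,
    lt_of_lt_of_le one_pos ((le_max_left _ _).trans hx2), hx1⟩

variable {n : ℕ} {p ν L : ℝ}

theorem rr_sp1 (P : RRPar n p ν L) {r : ℝ} (hr : 0 < r) :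
    (L * r ^ (-ν)) ^ (p - 1) = L ^ (p - 1) * r ^ (-2 : ℝ) := by
  rw [mul_rpow P.L_pos.le (rpow_pos_of_pos hr _).le, ← rpow_mul hr.le]
  congr 2; linarith [P.νp]

theorem rr_sp (P : RRPar n p ν L) {r : ℝ} (hr : 0 < r) :
    (L * r ^ (-ν)) ^ p = L * ν * ((n:ℝ) - 2 - ν) * r ^ (-ν - 2) := by
  have h0 : 0 < L * r ^ (-ν) := mul_pos P.L_pos (rpow_pos_of_pos hr _)
  have : (L * r ^ (-ν)) ^ p = (L * r ^ (-ν)) ^ (p - 1) * (L * r ^ (-ν)) := by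
    rw [← rpow_add_one h0.ne']; congr 1; ring
  rw [this, rr_sp1 P hr, P.Lp, show -ν - 2 = -2 + -ν by ring, rpow_add hr]
  ring

theorem rr_step1 (P : RRPar n p ν L) {v : ℝ → ℝ → ℝ} {v₀ : ℝ → ℝ}
    (hv : IsRadialSol n p v v₀) (h0 : ∀ r > (0:ℝ), v₀ r ≤ L * r ^ (-ν)) :
    ∀ r > (0:ℝ), ∀ t ≥ (0:ℝ), v r t ≤ L * r ^ (-ν) := by
  intro r₁ hr₁ t₁ ht₁
  obtain ⟨M, hM⟩ := hv.bdd (t₁ + 1) (by linarith)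
  have hp := P.hp
  have hLp : 0 < L ^ (p - 1) := rpow_pos_of_pos P.L_pos _
  have hn := P.hn
  set lam := 1 + (2 * n + 1) / (p * L ^ (p - 1)) with hlam
  have hlam0 : 0 < lam := by positivity
  refine rr_eps (C := exp (lam * t₁) * (1 * r₁ ^ (2:ℝ))) (by positivity) ?_
  intro ε hε
  obtain ⟨ρ, hρ, hρr, hρM⟩ := rr_near0 P.ν_pos P.L_pos M r₁ hr₁
  obtain ⟨R, hRr, hR0, hRM⟩ : ∃ R, r₁ ≤ R ∧ 0 < R ∧ M < ε * R ^ (2:ℝ) := by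
    obtain ⟨x, hx1, hx2⟩ := ((((tendsto_rpow_atTop (y := 2) (by norm_num)).const_mul_atTop
      hε).eventually_gt_atTop M).and (eventually_ge_atTop (max 1 r₁))).exists
    exact ⟨x, (le_max_right _ _).trans hx2,
      lt_of_lt_of_le one_pos ((le_max_left _ _).trans hx2), hx1⟩
  have hspos : ∀ r > 0, 0 < L * r ^ (-ν) := fun r hr => mul_pos P.L_pos (rpow_pos_of_pos hr _)
  have key := rr_upper3 hp hv 0 0 ε lam (rr_c2_rpow L (-ν)) (rr_c2_const 0)
    (rr_c2_rpow 1 2) ρ R 0 (t₁ + 1) hρ le_rfl ?_ ?_ ?_ ?_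
  · have := key r₁ ⟨hρr, hRr⟩ t₁ ⟨ht₁, by linarith⟩
    simpa [mul_assoc] using this
  · intro r hr
    have hr0 : 0 < r := hρ.trans_le hr.1
    rw [hv.init r hr0.le]
    have := h0 r hr0
    have : 0 < ε * exp (lam * 0) * (1 * r ^ (2:ℝ)) := by positivity
    simp only [mul_zero, add_zero]
    simp only [mul_zero] at this
    linarith [h0 r hr0]
  · intro t ht
    have h1 := hM ρ hρ.le t ht
    have : 0 < ε * exp (lam * t) * (1 * ρ ^ (2:ℝ)) := by positivity
    linarith
  · intro t ht
    have h1 := hM R hR0.le t ht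
    have h2 := hspos R hR0
    have h3 : 1 ≤ exp (lam * t) := one_le_exp (mul_nonneg hlam0.le ht.1)
    have h4 : ε * R ^ (2:ℝ) ≤ ε * exp (lam * t) * (1 * R ^ (2:ℝ)) := by
      have : 0 < ε * R ^ (2:ℝ) := by positivity
      nlinarith
    linarith
  · intro r hr t ht heq
    have hr0 : 0 < r := hρ.trans hr.1
    rw [rr_lap _ _ _ _ hr0, rr_lap _ _ _ _ hr0]
    set D := ε * exp (lam * t) with hD
    have hDp : 0 < D := by positivity
    have hs := hspos r hr0
    have hr2 : 0 < r ^ (2:ℝ) := by positivity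
    have hvs : L * r ^ (-ν) ≤ v r t := by
      rw [heq]; nlinarith [mul_pos hDp hr2]
    have hc := rr_conv hp hs.le hvs
    rw [rr_sp P hr0] at hc
    have hmono : L ^ (p - 1) * r ^ (-2:ℝ) ≤ v r t ^ (p - 1) := by
      rw [← rr_sp1 P hr0]; exact rpow_le_rpow hs.le hvs (by linarith)
    have hd : v r t - L * r ^ (-ν) = D * r ^ (2:ℝ) := by rw [heq]; ring
    rw [hd] at hc
    have hm2 : L ^ (p - 1) ≤ v r t ^ (p - 1) * r ^ (2:ℝ) := by
      have := mul_le_mul_of_nonneg_right hmono hr2.le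
      rwa [mul_assoc, ← rpow_add hr0, neg_add_cancel, rpow_zero, mul_one] at this
    have h5 : (2 * (n:ℝ) + 1) ≤ (lam - 1) * p * (v r t ^ (p - 1) * r ^ (2:ℝ)) := by
      have e : (2 * (n:ℝ) + 1) = (lam - 1) * p * L ^ (p - 1) := by
        rw [hlam]; field_simp; ring
      rw [e]
      apply mul_le_mul_of_nonneg_left hm2
      have : 0 ≤ (lam - 1) := by rw [hlam, add_sub_cancel_left]; positivity
      positivity
    have h6 : r ^ ((2:ℝ) - 2) = 1 := by simp
    rw [h6]
    have h7 : D * (2 * (n:ℝ)) < D * ((lam - 1) * p * (v r t ^ (p - 1) * r ^ (2:ℝ))) :=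
      mul_lt_mul_of_pos_left (by linarith) hDp
    nlinarith [hc, h7]

theorem rr_step2 (P : RRPar n p ν L) {v : ℝ → ℝ → ℝ} {v₀ : ℝ → ℝ}
    (hv : IsRadialSol n p v v₀) (hs : ∀ r > (0:ℝ), ∀ t ≥ (0:ℝ), v r t ≤ L * r ^ (-ν))
    (K : ℝ) (hK : L < K) (h0 : ∀ r > (0:ℝ), v₀ r ≤ K) :
    ∀ r > (0:ℝ), ∀ t ≥ (0:ℝ), v r t ≤ K * exp t := by
  intro r₁ hr₁ t₁ ht₁
  obtain ⟨M, hM⟩ := hv.bdd (t₁ + 1) (by linarith)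
  have hp := P.hp
  have hn := P.hn
  have hK0 : 0 < K := P.L_pos.trans hK
  refine rr_eps (C := exp (1 * t₁) * (1 * r₁ ^ (-1:ℝ))) (by positivity) ?_
  intro ε hε
  obtain ⟨ρ, hρ, hρr, hρM⟩ := rr_near0 (a := 1) one_pos hε M r₁ hr₁
  have key := rr_upper3 hp hv K 1 ε 1 (rr_c2_const 0) (rr_c2_const 1)
    (rr_c2_rpow 1 (-1)) ρ (max 1 r₁) 0 (t₁ + 1) hρ le_rfl ?_ ?_ ?_ ?_
  · have := key r₁ ⟨hρr, le_max_right _ _⟩ t₁ ⟨ht₁, by linarith⟩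
    simpa [mul_assoc] using this
  · intro r hr
    have hr0 : 0 < r := hρ.trans_le hr.1
    rw [hv.init r hr0.le]
    have : 0 < ε * exp (1 * 0) * (1 * r ^ (-1:ℝ)) := by positivity
    simp only [mul_zero, exp_zero, mul_one] at this ⊢
    linarith [h0 r hr0]
  · intro t ht
    have h1 := hM ρ hρ.le t ht
    have h3 : 1 ≤ exp (1 * t) := one_le_exp (mul_nonneg one_pos.le ht.1)
    have : 0 < ε * ρ ^ (-1:ℝ) := by positivity
    have : 0 < K * exp (1 * t) := by positivity
    nlinarith
  · intro t ht
    have hR1 : 1 ≤ max 1 r₁ := le_max_left _ _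
    have hR0 : 0 < max 1 r₁ := by linarith
    have h1 := hs _ hR0 t ht.1
    have h2 : (max 1 r₁) ^ (-ν) ≤ 1 := rpow_le_one_of_one_le_of_nonpos hR1 (by linarith [P.ν_pos])
    have h3 : 1 ≤ exp (1 * t) := one_le_exp (mul_nonneg one_pos.le ht.1)
    have : 0 < ε * exp (1 * t) * (1 * (max 1 r₁) ^ (-1:ℝ)) := by positivity
    nlinarith [P.L_pos]
  · intro r hr t ht heq
    have hr0 : 0 < r := hρ.trans hr.1
    rw [rr_lap _ _ _ _ hr0]
    have hvp : 0 < v r t := by rw [heq]; positivity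
    have h2 : v r t ^ p = v r t ^ (p - 1) * v r t := by
      rw [← rpow_add_one hvp.ne']; congr 1; ring
    have h3 : 0 < v r t ^ (p - 1) * v r t := by positivity
    have h4 : p * v r t ^ (p - 1) * (1 * (K * exp (1 * t) * 1) +
        1 * (ε * exp (1 * t) * (1 * r ^ (-1:ℝ)))) = p * (v r t ^ (p - 1) * v r t) := by
      nth_rw 3 [heq]; ring
    rw [h4, h2]
    have h5 : 0 < ε * exp (1 * t) * (((n:ℝ) - 3) * r ^ ((-1:ℝ) - 2)) := by
      have : 0 < (n:ℝ) - 3 := by linarith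
      positivity
    have h6 : ε * exp (1 * t) * (1 * (-1) * (-1 + (n:ℝ) - 2) * r ^ ((-1:ℝ) - 2)) < 0 := by
      linarith
    have h7 := mul_lt_mul_of_pos_right hp h3
    have z : ((n:ℝ) - 1) / r * 0 = 0 := mul_zero _
    rw [z]
    linarith

/-- steady state data -/
structure RRSteady (n : ℕ) (p : ℝ) (φ φ1 φ2 : ℝ → ℝ) : Prop where
  c2 : RRC2 φ φ1 φ2
  pos : ∀ r > (0:ℝ), 0 < φ r
  ode : ∀ r > (0:ℝ), φ2 r + ((n:ℝ) - 1) / r * φ1 r = - φ r ^ p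

theorem rr_step3 (P : RRPar n p ν L) {v : ℝ → ℝ → ℝ} {v₀ : ℝ → ℝ}
    (hv : IsRadialSol n p v v₀) (hs : ∀ r > (0:ℝ), ∀ t ≥ (0:ℝ), v r t ≤ L * r ^ (-ν))
    {φ φ1 φ2 : ℝ → ℝ} (S : RRSteady n p φ φ1 φ2) (M γ κ : ℝ) (hM : 0 < M) (hγ : 0 < γ)
    (hγ2 : γ < (n:ℝ) - 2) (hκ : (1 + κ) * (p * L ^ (p - 1)) = γ * ((n:ℝ) - 2 - γ))
    (h0 : ∀ r > (0:ℝ), v₀ r ≤ φ r + M * r ^ (-γ)) :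
    ∀ r > (0:ℝ), ∀ t ≥ (0:ℝ), v r t ≤ φ r + M * exp (-κ * t) * r ^ (-γ) := by
  intro r₁ hr₁ t₁ ht₁
  obtain ⟨B, hB⟩ := hv.bdd (t₁ + 1) (by linarith)
  have hp := P.hp
  have hn := P.hn
  have hLp : 0 < L ^ (p - 1) := rpow_pos_of_pos P.L_pos _
  have hκ1 : 0 ≤ 1 + κ := by
    by_contra hcon
    push Not at hcon
    have : 0 < γ * ((n:ℝ) - 2 - γ) := mul_pos hγ (by linarith)
    nlinarith [mul_pos (lt_trans one_pos hp) hLp]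
  refine rr_eps (C := exp (2 * t₁) * 1) (by positivity) ?_
  intro ε hε
  obtain ⟨ρ, hρ, hρr, hρM⟩ := rr_near0 (a := γ) (c := M * exp (-(|κ| * (t₁ + 1)))) hγ
    (by positivity) B r₁ hr₁
  obtain ⟨R, hRr, hR0, hRε⟩ := rr_far P.ν_pos L ε r₁ hε
  have key := rr_upper3 hp hv M (-κ) ε 2 S.c2 (rr_c2_rpow 1 (-γ)) (rr_c2_const 1)
    ρ R 0 (t₁ + 1) hρ le_rfl ?_ ?_ ?_ ?_
  · have := key r₁ ⟨hρr, hRr⟩ t₁ ⟨ht₁, by linarith⟩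
    simpa [mul_assoc] using this
  · intro r hr
    have hr0 : 0 < r := hρ.trans_le hr.1
    rw [hv.init r hr0.le]
    simp only [mul_zero, exp_zero, mul_one, one_mul]
    linarith [h0 r hr0]
  · intro t ht
    have h1 := hB ρ hρ.le t ht
    have h3 : exp (-(|κ| * (t₁ + 1))) ≤ exp (-κ * t) := by
      apply exp_le_exp.2
      have : κ * t ≤ |κ| * (t₁ + 1) :=
        mul_le_mul (le_abs_self κ) ht.2 ht.1 (abs_nonneg _)
      linarith
    have h4 : 0 < ρ ^ (-γ) := by positivity
    have h5 : M * exp (-(|κ| * (t₁ + 1))) * ρ ^ (-γ) ≤ M * exp (-κ * t) * (1 * ρ ^ (-γ)) := by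
      rw [one_mul]; gcongr
    have : 0 < ε * exp (2 * t) * 1 := by positivity
    linarith [S.pos ρ hρ]
  · intro t ht
    have h1 := hs R hR0 t ht.1
    have h3 : 1 ≤ exp (2 * t) := one_le_exp (mul_nonneg two_pos.le ht.1)
    have : 0 < M * exp (-κ * t) * (1 * R ^ (-γ)) := by positivity
    nlinarith [S.pos R hR0]
  · intro r hr t ht heq
    have hr0 : 0 < r := hρ.trans hr.1
    rw [rr_lap _ _ _ _ hr0, S.ode r hr0]
    have hφ := S.pos r hr0
    set D1 := M * exp (-κ * t) * r ^ (-γ) with hD1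
    have hD1p : 0 < D1 := by positivity
    set D2 := ε * exp (2 * t) with hD2
    have hD2p : 0 < D2 := by positivity
    have hveq : v r t = φ r + D1 + D2 := by rw [heq, hD1]; ring
    have hvp : 0 < v r t := by rw [hveq]; positivity
    have hc := rr_conv (x := v r t) hp hφ.le (by linarith)
    have hmono : v r t ^ (p - 1) ≤ L ^ (p - 1) * r ^ (-2:ℝ) := by
      rw [← rr_sp1 P hr0]
      exact rpow_le_rpow hvp.le (hs r hr0 t (ht.1.le)) (by linarith)
    have hW : 0 < v r t ^ (p - 1) := by positivity
    rw [show v r t - φ r = D1 + D2 by linarith] at hc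
    have e1 : M * exp (-κ * t) * (1 * -γ * (-γ + (n:ℝ) - 2) * r ^ (-γ - 2))
        = - (γ * ((n:ℝ) - 2 - γ)) * D1 * r ^ (-2:ℝ) := by
      rw [hD1, show -γ - 2 = -γ + -2 by ring, rpow_add hr0]; ring
    have e2 : M * exp (-κ * t) * (1 * r ^ (-γ)) = D1 := by rw [hD1]; ring
    rw [e1, e2, ← hκ]
    have h1 : (1 + κ) * p * D1 * v r t ^ (p - 1) ≤ (1 + κ) * p * D1 * (L ^ (p - 1) * r ^ (-2:ℝ)) :=
      mul_le_mul_of_nonneg_left hmono (by positivity)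
    have h2 : 0 < p * v r t ^ (p - 1) * D2 := by positivity
    nlinarith

theorem rr_step6 (P : RRPar n p ν L) {v : ℝ → ℝ → ℝ} {v₀ : ℝ → ℝ}
    (hv : IsRadialSol n p v v₀) (hs : ∀ r > (0:ℝ), ∀ t ≥ (0:ℝ), v r t ≤ L * r ^ (-ν))
    {φ φ1 φ2 : ℝ → ℝ} (S : RRSteady n p φ φ1 φ2) (t0 : ℝ) (ht0 : 0 ≤ t0)
    (h0 : ∀ r > (0:ℝ), v r t0 ≤ φ r) :
    ∀ r > (0:ℝ), ∀ t ≥ t0, v r t ≤ φ r := by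
  intro r₁ hr₁ t₁ ht₁
  obtain ⟨B, hB⟩ := hv.bdd (t₁ + 1) (by linarith)
  have hp := P.hp
  have hn := P.hn
  refine rr_eps (C := exp (2 * t₁) * 1 + exp (2 * t₁) * (1 * r₁ ^ (-1:ℝ))) (by positivity) ?_
  intro ε hε
  obtain ⟨ρ, hρ, hρr, hρM⟩ := rr_near0 (a := 1) (c := ε) one_pos hε B r₁ hr₁
  obtain ⟨R, hRr, hR0, hRε⟩ := rr_far P.ν_pos L ε r₁ hε
  have key := rr_upper3 hp hv ε 2 ε 2 S.c2 (rr_c2_const 1) (rr_c2_rpow 1 (-1))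
    ρ R t0 (t₁ + 1) hρ ht0 ?_ ?_ ?_ ?_
  · have := key r₁ ⟨hρr, hRr⟩ t₁ ⟨ht₁, by linarith⟩
    linarith
  · intro r hr
    have hr0 : 0 < r := hρ.trans_le hr.1
    have : 0 < ε * exp (2 * t0) * 1 := by positivity
    have : 0 < ε * exp (2 * t0) * (1 * r ^ (-1:ℝ)) := by positivity
    linarith [h0 r hr0]
  · intro t ht
    have h1 := hB ρ hρ.le t ⟨ht0.trans ht.1, ht.2⟩
    have h3 : 1 ≤ exp (2 * t) := one_le_exp (mul_nonneg two_pos.le (ht0.trans ht.1))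
    have : 0 < ε * exp (2 * t) * 1 := by positivity
    have : 0 < ε * ρ ^ (-1:ℝ) := by positivity
    nlinarith [S.pos ρ hρ]
  · intro t ht
    have h1 := hs R hR0 t (ht0.trans ht.1)
    have h3 : 1 ≤ exp (2 * t) := one_le_exp (mul_nonneg two_pos.le (ht0.trans ht.1))
    have : 0 < ε * exp (2 * t) * (1 * R ^ (-1:ℝ)) := by positivity
    nlinarith [S.pos R hR0]
  · intro r hr t ht heq
    have hr0 : 0 < r := hρ.trans hr.1
    rw [rr_lap _ _ _ _ hr0, S.ode r hr0]
    have hφ := S.pos r hr0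
    set D := ε * exp (2 * t) * 1 + ε * exp (2 * t) * (1 * r ^ (-1:ℝ)) with hD
    have hDp : 0 < D := by positivity
    have hveq : v r t = φ r + D := by rw [heq, hD]; ring
    have hvp : 0 < v r t := by rw [hveq]; positivity
    have hc := rr_conv (x := v r t) hp hφ.le (by linarith)
    rw [show v r t - φ r = D by linarith] at hc
    have h5 : 0 < ε * exp (2 * t) * (((n:ℝ) - 3) * r ^ ((-1:ℝ) - 2)) := by
      have : 0 < (n:ℝ) - 3 := by linarith
      positivity
    have h2 : 0 < p * v r t ^ (p - 1) * D := by positivity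
    have e : p * v r t ^ (p - 1) * (2 * (ε * exp (2 * t) * 1) + 2 * (ε * exp (2 * t) *
      (1 * r ^ (-1:ℝ)))) = 2 * (p * v r t ^ (p - 1) * D) := by rw [hD]; ring
    rw [e]
    have z : ((n:ℝ) - 1) / r * 0 = 0 := mul_zero _
    rw [z]
    linarith

theorem rr_step7 (P : RRPar n p ν L) {v : ℝ → ℝ → ℝ} {v₀ : ℝ → ℝ}
    (hv : IsRadialSol n p v v₀)
    {φ φ1 φ2 : ℝ → ℝ} (S : RRSteady n p φ φ1 φ2) (t0 : ℝ) (ht0 : 0 ≤ t0) (κ β B N R : ℝ)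
    (hκ1 : 0 ≤ 1 + κ) (hR : 0 < R) (hB : 0 ≤ B) (hN : 0 < N) (hBR : B * R ^ 2 ≤ 1 / 2)
    (hBβ : (1 + κ) * p * β ^ (p - 1) ≤ 2 * n * B)
    (hvβ : ∀ r > (0:ℝ), ∀ t ≥ t0, v r t ≤ β)
    (h0 : ∀ r > (0:ℝ), r ≤ R → v r t0 ≤ φ r + N / 2 * exp (-κ * t0))
    (hbd : ∀ t ≥ t0, v R t ≤ φ R + N / 2 * exp (-κ * t)) :
    ∀ r > (0:ℝ), r ≤ R → ∀ t ≥ t0, v r t ≤ φ r + N * exp (-κ * t) := by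
  intro r₁ hr₁ hr₁R t₁ ht₁
  have hp := P.hp
  have hn := P.hn
  refine rr_eps (C := exp (2 * t₁) * (1 * r₁ ^ (-1:ℝ))) (by positivity) ?_
  intro ε hε
  obtain ⟨ρ, hρ, hρr, hρM⟩ := rr_near0 (a := 1) (c := ε) one_pos hε β r₁ hr₁
  have hsm : ∀ r : ℝ, 0 < r → r ≤ R → 1 / 2 ≤ 1 - B * r ^ 2 := by
    intro r hr hrR
    have : r ^ 2 ≤ R ^ 2 := by gcongr
    nlinarith
  have hg : RRC2 (fun r : ℝ => 1 - B * r ^ 2) (fun r => - (2 * B * r)) (fun _ => - (2 * B)) := by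
    intro r hr
    constructor
    · have := ((hasDerivAt_pow 2 r).const_mul B).const_sub 1
      refine this.congr_deriv ?_
      norm_num; ring
    · have := ((hasDerivAt_id r).const_mul (2 * B)).neg
      exact this.congr_deriv (by ring)
  have key := rr_upper3 hp hv N (-κ) ε 2 S.c2 hg (rr_c2_rpow 1 (-1))
    ρ R t0 (t₁ + 1) hρ ht0 ?_ ?_ ?_ ?_
  · have := key r₁ ⟨hρr, hr₁R⟩ t₁ ⟨ht₁, by linarith⟩
    have h2 : N * exp (-κ * t₁) * (1 - B * r₁ ^ 2) ≤ N * exp (-κ * t₁) * 1 :=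
      mul_le_mul_of_nonneg_left (by nlinarith [sq_nonneg r₁]) (by positivity)
    linarith
  · intro r hr
    have hr0 : 0 < r := hρ.trans_le hr.1
    have : 0 < ε * exp (2 * t0) * (1 * r ^ (-1:ℝ)) := by positivity
    have h2 : N * exp (-κ * t0) * (1 / 2) ≤ N * exp (-κ * t0) * (1 - B * r ^ 2) :=
      mul_le_mul_of_nonneg_left (hsm r hr0 hr.2) (by positivity)
    linarith [h0 r hr0 hr.2]
  · intro t ht
    have h1 := hvβ ρ hρ t ht.1
    have h3 : 1 ≤ exp (2 * t) := one_le_exp (mul_nonneg two_pos.le (ht0.trans ht.1))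
    have h2 : N * exp (-κ * t) * (1 / 2) ≤ N * exp (-κ * t) * (1 - B * ρ ^ 2) :=
      mul_le_mul_of_nonneg_left (hsm ρ hρ (hρr.trans hr₁R)) (by positivity)
    have : 0 < N * exp (-κ * t) := by positivity
    have : 0 < ε * ρ ^ (-1:ℝ) := by positivity
    nlinarith [S.pos ρ hρ]
  · intro t ht
    have : 0 < ε * exp (2 * t) * (1 * R ^ (-1:ℝ)) := by positivity
    have h2 : N * exp (-κ * t) * (1 / 2) ≤ N * exp (-κ * t) * (1 - B * R ^ 2) :=
      mul_le_mul_of_nonneg_left (hsm R hR le_rfl) (by positivity)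
    linarith [hbd t ht.1]
  · intro r hr t ht heq
    have hr0 : 0 < r := hρ.trans hr.1
    rw [rr_lap _ _ _ _ hr0, S.ode r hr0]
    have hφ := S.pos r hr0
    set E := N * exp (-κ * t) with hE
    have hEp : 0 < E := by positivity
    set Z := 1 - B * r ^ 2 with hZ
    have hZ1 : Z ≤ 1 := by rw [hZ]; nlinarith [sq_nonneg r]
    have hZ0 : 1 / 2 ≤ Z := hsm r hr0 hr.2.le
    set D2 := ε * exp (2 * t) * (1 * r ^ (-1:ℝ)) with hD2
    have hD2p : 0 < D2 := by positivity
    have hEZ : 0 < E * Z := by apply mul_pos hEp; linarith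
    have hvp : 0 < v r t := by rw [heq]; positivity
    have hc := rr_conv (x := v r t) hp hφ.le (by linarith)
    have hmono : v r t ^ (p - 1) ≤ β ^ (p - 1) :=
      rpow_le_rpow hvp.le (hvβ r hr0 t (ht.1.le)) (by linarith)
    have hW : 0 < v r t ^ (p - 1) := by positivity
    rw [show v r t - φ r = E * Z + D2 by linarith] at hc
    have h5 : 0 < ε * exp (2 * t) * (((n:ℝ) - 3) * r ^ ((-1:ℝ) - 2)) := by
      have : 0 < (n:ℝ) - 3 := by linarith
      positivity
    have e1 : -(2 * B) + ((n:ℝ) - 1) / r * -(2 * B * r) = - (2 * n * B) := by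
      field_simp; ring
    rw [e1]
    have hβ : 0 ≤ β ^ (p - 1) := hW.le.trans hmono
    have h1 : (1 + κ) * p * v r t ^ (p - 1) * (E * Z) ≤ (2 * n * B) * E := by
      calc (1 + κ) * p * v r t ^ (p - 1) * (E * Z)
          ≤ (1 + κ) * p * β ^ (p - 1) * (E * 1) := by
            apply mul_le_mul _ _ hEZ.le (mul_nonneg (mul_nonneg hκ1 (by linarith)) hβ)
            · exact mul_le_mul_of_nonneg_left hmono (mul_nonneg hκ1 (by linarith))
            · exact mul_le_mul_of_nonneg_left hZ1 hEp.le
        _ ≤ _ := by rw [mul_one]; exact mul_le_mul_of_nonneg_right hBβ hEp.le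
    have h2 : 0 < p * v r t ^ (p - 1) * D2 := by positivity
    linarith

theorem rr_step5 (P : RRPar n p ν L) (ρ R η : ℝ) (hρ : 0 < ρ) (hρR : ρ < R) (hη : 0 < η) :
    ∃ η' > 0, ∀ (v : ℝ → ℝ → ℝ) (v₀ : ℝ → ℝ), IsRadialSol n p v v₀ →
      (∀ r > (0:ℝ), ∀ t ≥ (0:ℝ), v r t ≤ L * r ^ (-ν)) →
      (∀ t ∈ Icc (0:ℝ) 1, v ρ t + η ≤ L * ρ ^ (-ν)) →
      (∀ t ∈ Icc (0:ℝ) 1, v R t + η ≤ L * R ^ (-ν)) →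
      ∀ r ∈ Icc ρ R, v r 1 ≤ L * r ^ (-ν) - η' := by
  have hp := P.hp
  have hn := P.hn
  have hLp : 0 < L ^ (p - 1) := rpow_pos_of_pos P.L_pos _
  obtain ⟨Q, hQ⟩ : ∃ Q, Q = L ^ (p - 1) * ρ ^ (-2:ℝ) := ⟨_, rfl⟩
  have hQ0 : 0 < Q := by rw [hQ]; positivity
  have hd : 0 < R - ρ := sub_pos.2 hρR
  obtain ⟨A, hA⟩ : ∃ A, A = p * Q * (R - ρ) + p * Q + 1 := ⟨_, rfl⟩
  have hA1 : 1 ≤ A := by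
    have : 0 < p * Q * (R - ρ) := by positivity
    have : 0 < p * Q := by positivity
    linarith
  obtain ⟨B, hB⟩ : ∃ B, B = A * (R - ρ) + 1 := ⟨_, rfl⟩
  have hB0 : 0 < B := by rw [hB]; positivity
  have hAB : p * Q * B < A ^ 2 := by
    have e : A ^ 2 = p * Q * B + (p * Q * (A - 1) + A) := by
      rw [hB, pow_two]; nth_rw 1 [hA]; ring
    have : 0 ≤ p * Q * (A - 1) := mul_nonneg (by positivity) (by linarith)
    linarith
  refine ⟨η * (exp (A * (ρ - R)) - exp (-B * 1)), ?_, ?_⟩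
  · apply mul_pos hη
    rw [sub_pos, exp_lt_exp, hB]; linarith
  intro v v₀ hv hs hl hr r₁ hr₁
  suffices h : v r₁ 1 ≤ L * r₁ ^ (-ν) - η * exp (A * (r₁ - R)) + η * exp (-B * 1) * 1 by
    have : exp (A * (ρ - R)) ≤ exp (A * (r₁ - R)) := by
      apply exp_le_exp.2
      apply mul_le_mul_of_nonneg_left _ (by linarith)
      linarith [hr₁.1]
    nlinarith
  refine rr_eps (C := 1) one_pos ?_
  intro δ hδ
  have hf : RRC2 (fun r => L * r ^ (-ν) - η * exp (A * (r - R)))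
      (fun r => L * (-ν) * r ^ (-ν - 1) - η * A * exp (A * (r - R)))
      (fun r => L * (-ν) * (-ν - 1) * r ^ (-ν - 2) - η * A ^ 2 * exp (A * (r - R))) := by
    intro r hr
    have hx : HasDerivAt (fun r => exp (A * (r - R))) (A * exp (A * (r - R))) r := by
      have := (((hasDerivAt_id r).sub_const R).const_mul A).exp
      exact this.congr_deriv (by simp; ring)
    have hy := rr_c2_rpow L (-ν) r hr
    exact ⟨(hy.1.sub (hx.const_mul η)).congr_deriv (by ring),
      (hy.2.sub (hx.const_mul (η * A))).congr_deriv (by ring)⟩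
  have key := rr_upper3 hp hv η (-B) δ 0 hf (rr_c2_const 1) (rr_c2_const 1)
    ρ R 0 1 hρ le_rfl ?_ ?_ ?_ ?_
  · have := key r₁ hr₁ 1 ⟨zero_le_one, le_rfl⟩
    simp only [zero_mul, exp_zero, mul_one] at this ⊢
    linarith
  · intro r hr
    have hr0 : 0 < r := hρ.trans_le hr.1
    have : exp (A * (r - R)) ≤ 1 := exp_le_one_iff.2
      (mul_nonpos_of_nonneg_of_nonpos (by linarith) (by linarith [hr.2]))
    simp only [mul_zero, exp_zero, mul_one]
    nlinarith [hs r hr0 0 le_rfl]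
  · intro t ht
    have : exp (A * (ρ - R)) ≤ 1 := exp_le_one_iff.2
      (mul_nonpos_of_nonneg_of_nonpos (by linarith) (by linarith))
    have h2 : 0 < η * exp (-B * t) := by positivity
    simp only [zero_mul, exp_zero, mul_one]
    nlinarith [hl t ht]
  · intro t ht
    have h2 : 0 < η * exp (-B * t) := by positivity
    simp only [zero_mul, exp_zero, mul_one, sub_self, mul_zero]
    linarith [hr t ht]
  · intro r hr t ht heq
    have hr0 : 0 < r := hρ.trans hr.1
    have hsr := hs r hr0 t ht.1.le
    have hv0 := hv.nonneg r hr0.le t ht.1.le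
    simp only [zero_mul, exp_zero, mul_one, mul_zero, add_zero] at heq ⊢
    have hvp : v r t ^ p ≤ L * ν * ((n:ℝ) - 2 - ν) * r ^ (-ν - 2) := by
      rw [← rr_sp P hr0]; exact rpow_le_rpow hv0 hsr (by linarith)
    have hvp1 : v r t ^ (p - 1) ≤ Q := by
      calc v r t ^ (p - 1) ≤ _ := rpow_le_rpow hv0 hsr (by linarith)
        _ = L ^ (p - 1) * r ^ (-2:ℝ) := rr_sp1 P hr0
        _ ≤ Q := by
          rw [hQ]
          apply mul_le_mul_of_nonneg_left _ hLp.le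
          exact rpow_le_rpow_of_nonpos hρ hr.1.le (by norm_num)
    have hlap := rr_lap n L (-ν) r hr0
    set X := exp (A * (r - R)) with hX
    have hX0 : 0 < X := exp_pos _
    set Y := exp (-B * t) with hY
    have hY0 : 0 < Y := exp_pos _
    have hYX : Y ≤ X := by
      have : η * Y ≤ η * X := by linarith
      exact le_of_mul_le_mul_left this hη
    have h1 : p * v r t ^ (p - 1) * (B * (η * Y)) < η * A ^ 2 * X := by
      calc p * v r t ^ (p - 1) * (B * (η * Y)) ≤ p * Q * (B * (η * X)) := by gcongr
        _ = (p * Q * B) * (η * X) := by ring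
        _ < A ^ 2 * (η * X) := mul_lt_mul_of_pos_right hAB (by positivity)
        _ = _ := by ring
    have h2 : 0 < ((n:ℝ) - 1) / r * (η * A * X) := by
      have : 0 < (n:ℝ) - 1 := by linarith
      positivity
    have h3 : ((n:ℝ) - 1) / r * (L * (-ν) * r ^ (-ν - 1) - η * A * X)
      = ((n:ℝ) - 1) / r * (L * (-ν) * r ^ (-ν - 1)) - ((n:ℝ) - 1) / r * (η * A * X) := by ring
    rw [h3]
    nlinarith

theorem rr_scale (P : RRPar n p ν L) {φ φ1 φ2 : ℝ → ℝ} (S : RRSteady n p φ φ1 φ2)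
    (σ : ℝ) (hσ : 0 < σ) :
    RRSteady n p (fun r => σ ^ ν * φ (σ * r)) (fun r => σ ^ ν * σ * φ1 (σ * r))
      (fun r => σ ^ ν * σ ^ 2 * φ2 (σ * r)) := by
  refine ⟨?_, ?_, ?_⟩
  · intro r hr
    have hx : HasDerivAt (fun r => σ * r) σ r := by
      simpa using (hasDerivAt_id r).const_mul σ
    have h := S.c2 (σ * r) (mul_pos hσ hr)
    exact ⟨((h.1.comp r hx).const_mul (σ ^ ν)).congr_deriv (by ring),
      ((h.2.comp r hx).const_mul (σ ^ ν * σ)).congr_deriv (by ring)⟩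
  · intro r hr
    exact mul_pos (rpow_pos_of_pos hσ _) (S.pos _ (mul_pos hσ hr))
  · intro r hr
    have h := S.ode (σ * r) (mul_pos hσ hr)
    have h0 := S.pos (σ * r) (mul_pos hσ hr)
    have e : (σ ^ ν * φ (σ * r)) ^ p = σ ^ ν * σ ^ 2 * φ (σ * r) ^ p := by
      rw [mul_rpow (rpow_pos_of_pos hσ _).le h0.le, ← rpow_mul hσ.le,
        show ν * p = ν + 2 by linarith [P.νp], rpow_add hσ, rpow_two]
    have e2 : ((n:ℝ) - 1) / r * (σ ^ ν * σ * φ1 (σ * r))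
        = σ ^ ν * σ ^ 2 * (((n:ℝ) - 1) / (σ * r) * φ1 (σ * r)) := by
      field_simp
    rw [e, e2, ← mul_add, h]; ring

theorem rr_step56 (P : RRPar n p ν L) {φ φ1 φ2 : ℝ → ℝ} (S : RRSteady n p φ φ1 φ2)
    (α a l R₀ M γ κ K : ℝ) (ha : 0 < a) (hl : 0 < l) (hR₀ : 0 < R₀) (hM : 0 < M)
    (hγ : ν + l < γ) (hK : 0 < K)
    (hanti : ∀ r > (0:ℝ), ∀ s ≥ r, φ s ≤ φ r) (hφα : ∀ r > (0:ℝ), φ r ≤ α)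
    (hlo : ∀ r ≥ R₀, L * r ^ (-ν) - 2 * a * r ^ (-ν - l) ≤ φ r)
    (hup : ∀ r ≥ R₀, φ r ≤ L * r ^ (-ν) - a / 2 * r ^ (-ν - l)) :
    ∃ β, 0 < β ∧ ∀ (v : ℝ → ℝ → ℝ) (v₀ : ℝ → ℝ), IsRadialSol n p v v₀ →
      (∀ r > (0:ℝ), ∀ t ≥ (0:ℝ), v r t ≤ L * r ^ (-ν)) →
      (∀ r > (0:ℝ), ∀ t ≥ (0:ℝ), v r t ≤ K * exp t) →
      (∀ r > (0:ℝ), ∀ t ≥ (0:ℝ), v r t ≤ φ r + M * exp (-κ * t) * r ^ (-γ)) →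
      ∀ r > (0:ℝ), ∀ t ≥ (1:ℝ), v r t ≤ β := by
  have hα : 0 < α := (S.pos 1 one_pos).trans_le (hφα 1 one_pos)
  obtain ⟨R, hRR, hR0, hRM⟩ := rr_far (a := γ - ν - l) (by linarith) (M * exp |κ|) (a / 4)
    (max 2 R₀) (by linarith)
  have hR2 : 2 ≤ R := (le_max_left _ _).trans hRR
  have hRR₀ : R₀ ≤ R := (le_max_right _ _).trans hRR
  obtain ⟨ρ, hρ, hρ1, hρK⟩ := rr_near0 P.ν_pos P.L_pos (K * exp 1 + 1) 1 one_pos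
  have hfar : ∀ r ≥ R, M * exp |κ| * r ^ (-γ) ≤ a / 4 * r ^ (-ν - l) := by
    intro r hr
    have hr0 : 0 < r := hR0.trans_le hr
    have h1 : r ^ (-(γ - ν - l)) ≤ R ^ (-(γ - ν - l)) :=
      rpow_le_rpow_of_nonpos hR0 hr (by linarith)
    have h2 : r ^ (-γ) = r ^ (-(γ - ν - l)) * r ^ (-ν - l) := by
      rw [← rpow_add hr0]; congr 1; ring
    rw [h2, ← mul_assoc]
    apply mul_le_mul_of_nonneg_right _ (rpow_pos_of_pos hr0 _).le
    have : M * exp |κ| * r ^ (-(γ - ν - l)) ≤ M * exp |κ| * R ^ (-(γ - ν - l)) :=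
      mul_le_mul_of_nonneg_left h1 (by positivity)
    linarith
  have hRp : 0 < R ^ (-ν - l) := rpow_pos_of_pos hR0 _
  obtain ⟨η, hη⟩ : ∃ η, η = min 1 (a / 4 * R ^ (-ν - l)) := ⟨_, rfl⟩
  have hη0 : 0 < η := by rw [hη]; apply lt_min one_pos; positivity
  have hη1 : η ≤ 1 := by rw [hη]; exact min_le_left _ _
  have hη2 : η ≤ a / 4 * R ^ (-ν - l) := by rw [hη]; exact min_le_right _ _
  obtain ⟨η', hη'0, h5⟩ := rr_step5 P ρ R η hρ (by linarith) hη0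
  have hρl : 0 < ρ ^ (-ν - l) := rpow_pos_of_pos hρ _
  obtain ⟨σ, hσ1, hσ0, hσ2⟩ := rr_far hl (2 * a) (min (min η' 1 / ρ ^ (-ν - l)) (a / 4))
    (max 1 (R₀ / ρ)) (lt_min (div_pos (lt_min hη'0 one_pos) hρl) (by linarith))
  have hσ1' : 1 ≤ σ := (le_max_left _ _).trans hσ1
  have hσρ : R₀ ≤ σ * ρ := by
    have := (le_max_right _ _).trans hσ1
    rwa [div_le_iff₀ hρ] at this
  have hσa : 2 * a * σ ^ (-l) ≤ a / 4 := hσ2.le.trans (min_le_right _ _)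
  have hσb : 2 * a * σ ^ (-l) * ρ ^ (-ν - l) ≤ min η' 1 := by
    have := hσ2.le.trans (min_le_left _ _)
    rwa [le_div_iff₀ hρl] at this
  have hσν : 0 < σ ^ ν := rpow_pos_of_pos hσ0 _
  have hS := rr_scale P S σ hσ0
  have hψlo : ∀ r ≥ ρ, L * r ^ (-ν) - 2 * a * σ ^ (-l) * r ^ (-ν - l) ≤ σ ^ ν * φ (σ * r) := by
    intro r hr
    have hr0 : 0 < r := hρ.trans_le hr
    have h1 := hlo (σ * r) (hσρ.trans (mul_le_mul_of_nonneg_left hr hσ0.le))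
    have h2 := mul_le_mul_of_nonneg_left h1 hσν.le
    refine le_trans (le_of_eq ?_) h2
    have e0 : σ ^ ν * σ ^ (-ν) = 1 := by rw [← rpow_add hσ0]; simp
    rw [mul_rpow hσ0.le hr0.le, mul_rpow hσ0.le hr0.le, sub_eq_add_neg (-ν) l,
      rpow_add hσ0]
    linear_combination (- (L * r ^ (-ν)) + 2 * a * σ ^ (-l) * r ^ (-ν + -l)) * e0
  refine ⟨σ ^ ν * α, by positivity, ?_⟩
  intro v v₀ hv hs hKv h3 r hr t ht
  have h3' : ∀ r ≥ R, ∀ t ∈ Icc (0:ℝ) 1, v r t ≤ L * r ^ (-ν) - a / 4 * r ^ (-ν - l) := by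
    intro r hr t ht
    have hr0 : 0 < r := hR0.trans_le hr
    have e1 := h3 r hr0 t ht.1
    have e2 := hup r (hRR₀.trans hr)
    have e3 := hfar r hr
    have e4 : exp (-κ * t) ≤ exp |κ| := by
      apply exp_le_exp.2
      have : |κ * t| = |κ| * t := by rw [abs_mul, abs_of_nonneg ht.1]
      have h5 : |κ| * t ≤ |κ| * 1 := mul_le_mul_of_nonneg_left ht.2 (abs_nonneg _)
      linarith [neg_abs_le (κ * t)]
    have e5 : M * exp (-κ * t) * r ^ (-γ) ≤ M * exp |κ| * r ^ (-γ) := by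
      have := rpow_pos_of_pos hr0 (-γ)
      gcongr
    linarith
  have hmid := h5 v v₀ hv hs
    (by
      intro t ht
      have e1 := hKv ρ hρ t ht.1
      have e2 : K * exp t ≤ K * exp 1 :=
        mul_le_mul_of_nonneg_left (exp_le_exp.2 ht.2) hK.le
      linarith)
    (by
      intro t ht
      linarith [h3' R le_rfl t ht])
  have hinit : ∀ r > (0:ℝ), v r 1 ≤ σ ^ ν * φ (σ * r) := by
    intro r hr
    rcases lt_or_ge r ρ with h | h
    · have e1 := hKv r hr 1 zero_le_one
      have e2 := hψlo ρ le_rfl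
      have e3 := hanti (σ * r) (mul_pos hσ0 hr) (σ * ρ) (mul_le_mul_of_nonneg_left h.le hσ0.le)
      have e4 := mul_le_mul_of_nonneg_left e3 hσν.le
      linarith [hσb.trans (min_le_right _ _)]
    · have hr0 : 0 < r := hr
      have e2 := hψlo r h
      rcases le_or_gt r R with h' | h'
      · have e1 := hmid r ⟨h, h'⟩
        have e3 : r ^ (-ν - l) ≤ ρ ^ (-ν - l) :=
          rpow_le_rpow_of_nonpos hρ h (by linarith [P.ν_pos])
        have e4 : 2 * a * σ ^ (-l) * r ^ (-ν - l) ≤ 2 * a * σ ^ (-l) * ρ ^ (-ν - l) :=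
          mul_le_mul_of_nonneg_left e3 (by have := rpow_pos_of_pos hσ0 (-l); positivity)
        linarith [hσb.trans (min_le_left _ _)]
      · have e1 := h3' r h'.le 1 ⟨zero_le_one, le_rfl⟩
        have e3 := mul_le_mul_of_nonneg_right hσa (rpow_pos_of_pos hr0 (-ν - l)).le
        linarith
  have := rr_step6 P hv hs hS 1 zero_le_one hinit r hr t ht
  exact this.trans (mul_le_mul_of_nonneg_left (hφα _ (mul_pos hσ0 hr)) hσν.le)

theorem rr_phi1_lower {n : ℕ} {p ν L : ℝ} (P : RRPar n p ν L) {φ φ1 φ2 : ℝ → ℝ}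
    (S : RRSteady n p φ φ1 φ2) (α : ℝ) (hφα : ∀ r > (0:ℝ), φ r ≤ α) :
    ∀ r > (0:ℝ), -(α ^ p / n * r) ≤ φ1 r := by
  have hp := P.hp
  have hn := P.hn
  have hα : 0 < α := (S.pos 1 one_pos).trans_le (hφα 1 one_pos)
  obtain ⟨C, hC⟩ : ∃ C, C = α ^ p / n := ⟨_, rfl⟩
  have hC0 : 0 ≤ C := by rw [hC]; positivity
  have hnC : n * C = α ^ p := by rw [hC]; field_simp
  rw [← hC]
  have hg : ∀ r > (0:ℝ), HasDerivAt (fun r => r ^ ((n:ℝ) - 1) * (φ1 r + C * r))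
      (r ^ ((n:ℝ) - 1) * (α ^ p - φ r ^ p)) r := by
    intro r hr
    have h1 := hasDerivAt_rpow_const (x := r) (p := (n:ℝ) - 1) (Or.inl hr.ne')
    have h2 := (S.c2 r hr).2.add ((hasDerivAt_id r).const_mul C)
    refine (h1.mul h2).congr_deriv ?_
    have e : r ^ ((n:ℝ) - 1) = r ^ ((n:ℝ) - 1 - 1) * r := by
      rw [← rpow_add_one hr.ne']; congr 1; ring
    have ho := S.ode r hr
    have ho' : φ r ^ p = - (φ2 r + ((n:ℝ) - 1) / r * φ1 r) := by linarith
    simp only [Pi.add_apply, id_eq]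
    rw [ho', ← hnC, e]
    field_simp
    ring
  have hmono : MonotoneOn (fun r => r ^ ((n:ℝ) - 1) * (φ1 r + C * r)) (Ioi 0) := by
    apply monotoneOn_of_deriv_nonneg (convex_Ioi 0)
    · exact fun x hx => (hg x hx).continuousAt.continuousWithinAt
    · rw [interior_Ioi]
      exact fun x hx => (hg x hx).differentiableAt.differentiableWithinAt
    · rw [interior_Ioi]
      intro x hx
      rw [(hg x hx).deriv]
      have hx0 : 0 < x := hx
      have : φ x ^ p ≤ α ^ p := rpow_le_rpow (S.pos x hx).le (hφα x hx) (by linarith)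
      exact mul_nonneg (rpow_pos_of_pos hx0 _).le (by linarith)
  intro r₀ hr₀
  by_contra hcon
  push Not at hcon
  obtain ⟨c, hc⟩ : ∃ c, c = -(r₀ ^ ((n:ℝ) - 1) * (φ1 r₀ + C * r₀)) := ⟨_, rfl⟩
  have hc0 : 0 < c := by
    rw [hc, ← mul_neg]
    exact mul_pos (rpow_pos_of_pos hr₀ _) (by linarith)
  have hb : ∀ r > (0:ℝ), r ≤ r₀ → r ≤ 1 → φ1 r + C * r + c / r ≤ 0 := by
    intro r hr h1 h2
    have h3 := hmono (show r ∈ Ioi (0:ℝ) from hr) (show r₀ ∈ Ioi (0:ℝ) from hr₀) h1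
    simp only at h3
    have h4 : r ^ ((n:ℝ) - 1) ≤ r := by
      have := rpow_le_rpow_of_exponent_ge hr h2 (show (1:ℝ) ≤ (n:ℝ) - 1 by linarith)
      rwa [rpow_one] at this
    have h5 : 0 < r ^ ((n:ℝ) - 1) := rpow_pos_of_pos hr _
    have h6 : r ^ ((n:ℝ) - 1) * (φ1 r + C * r) ≤ -c := by linarith
    have h7 : φ1 r + C * r < 0 := by
      by_contra h8
      push Not at h8
      have := mul_nonneg h5.le h8
      linarith
    have h8 : r * (φ1 r + C * r) ≤ -c := by nlinarith
    have h9 : φ1 r + C * r ≤ -c / r := by rw [le_div_iff₀ hr]; linarith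
    rw [neg_div] at h9
    linarith
  obtain ⟨r₁, hr₁⟩ : ∃ r₁, r₁ = min r₀ 1 := ⟨_, rfl⟩
  have hr₁0 : 0 < r₁ := by rw [hr₁]; exact lt_min hr₀ one_pos
  have hk : ∀ r > (0:ℝ), HasDerivAt (fun r => φ r + C / 2 * r ^ 2 + c * log r)
      (φ1 r + C * r + c / r) r := by
    intro r hr
    have h1 := ((S.c2 r hr).1.add ((hasDerivAt_pow 2 r).const_mul (C / 2))).add
      ((hasDerivAt_log hr.ne').const_mul c)
    refine h1.congr_deriv ?_
    rw [div_eq_mul_inv c r]; norm_num; ring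
  have hanti : AntitoneOn (fun r => φ r + C / 2 * r ^ 2 + c * log r) (Ioc 0 r₁) := by
    apply antitoneOn_of_deriv_nonpos (convex_Ioc 0 r₁)
    · exact fun x hx => (hk x hx.1).continuousAt.continuousWithinAt
    · rw [interior_Ioc]
      exact fun x hx => (hk x hx.1).differentiableAt.differentiableWithinAt
    · rw [interior_Ioc]
      intro x hx
      rw [(hk x hx.1).deriv]
      apply hb x hx.1
      · exact hx.2.le.trans (hr₁ ▸ min_le_left _ _)
      · exact hx.2.le.trans (hr₁ ▸ min_le_right _ _)
  obtain ⟨k, hkk⟩ : ∃ k, k = φ r₁ + C / 2 * r₁ ^ 2 + c * log r₁ := ⟨_, rfl⟩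
  obtain ⟨r, hr1, hr2⟩ := ((tendsto_log_nhdsGT_zero.eventually_lt_atBot
    ((k - α - C) / c)).and (Ioo_mem_nhdsGT hr₁0)).exists
  have h1 := hanti ⟨hr2.1, hr2.2.le⟩ ⟨hr₁0, le_rfl⟩ hr2.2.le
  simp only at h1
  rw [lt_div_iff₀ hc0] at hr1
  have h2 := hφα r hr2.1
  have h3 : r ^ 2 ≤ 1 := by
    have : r ≤ 1 := hr2.2.le.trans (hr₁ ▸ min_le_right _ _)
    nlinarith [hr2.1]
  have h4 : C / 2 * r ^ 2 ≤ C / 2 := by nlinarith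
  nlinarith

theorem rr_geo {c r e : ℝ} (hc0 : 0 < c) (hc1 : c ≤ 1) (hr : 0 < r) (he : 0 < e)
    (he1 : e ≤ 1 / 16) (hθ : 1 / 2 ≤ e * (1 + r ^ 2 + c / r)) :
    (e * (1 + r ^ 2 + c / r)) ^ 2 / 9 ≤ (1 + r ^ 2) * (e * (2 * r - c / r ^ 2)) ^ 2 := by
  have hA : (1 + r ^ 2 + c / r) ^ 2 / 9 ≤ (1 + r ^ 2) * (2 * r - c / r ^ 2) ^ 2 := by
    have hq : 0 < c / r := div_pos hc0 hr
    rcases le_or_gt 1 r with h | h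
    · have h1 : c / r ≤ 1 := by rw [div_le_one hr]; linarith
      have h2 : c / r ^ 2 ≤ 1 := by rw [div_le_one (by positivity)]; nlinarith
      have h3 : 1 + r ^ 2 + c / r ≤ 3 * r ^ 2 := by nlinarith
      have h4 : r ≤ 2 * r - c / r ^ 2 := by linarith
      have h5 : (1 + r ^ 2 + c / r) ^ 2 ≤ (3 * r ^ 2) ^ 2 := by gcongr
      have h6 : r ^ 2 ≤ (2 * r - c / r ^ 2) ^ 2 := by gcongr
      have h7 : r ^ 2 * r ^ 2 ≤ (1 + r ^ 2) * (2 * r - c / r ^ 2) ^ 2 := by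
        gcongr; linarith
      nlinarith
    · have h0 : 8 ≤ 1 + r ^ 2 + c / r := by
        by_contra hcon
        push Not at hcon
        have : 0 < 1 + r ^ 2 + c / r := by positivity
        nlinarith
      have h1 : r ^ 2 ≤ 1 := by nlinarith
      have h2 : c / r ≤ c / r ^ 2 := by
        apply div_le_div_of_nonneg_left hc0.le (by positivity)
        nlinarith
      have h3 : (1 + r ^ 2 + c / r) / 2 ≤ c / r ^ 2 - 2 * r := by nlinarith
      have h4 : ((1 + r ^ 2 + c / r) / 2) ^ 2 ≤ (c / r ^ 2 - 2 * r) ^ 2 := by gcongr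
      have h5 : (c / r ^ 2 - 2 * r) ^ 2 = (2 * r - c / r ^ 2) ^ 2 := by ring
      rw [h5] at h4
      have h6 : 0 ≤ r ^ 2 * (2 * r - c / r ^ 2) ^ 2 := by positivity
      nlinarith [sq_nonneg (1 + r ^ 2 + c / r)]
  calc (e * (1 + r ^ 2 + c / r)) ^ 2 / 9 = e ^ 2 * ((1 + r ^ 2 + c / r) ^ 2 / 9) := by ring
    _ ≤ e ^ 2 * ((1 + r ^ 2) * (2 * r - c / r ^ 2) ^ 2) := by gcongr
    _ = _ := by ring

set_option maxHeartbeats 1000000 in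
theorem rr_scalar {p N c1 C1 x₀ δ lam θ X Y Q G : ℝ} (hp : 1 < p) (hN : 0 ≤ N) (hc1 : 0 < c1)
    (hC1 : 0 < C1) (hx₀ : 0 < x₀) (hx₀' : x₀ ≤ 1 / 2) (hx : x₀ * (C1 + 8 * N) ≤ 1 / 4)
    (hδ : 0 < δ) (hδx : δ ≤ x₀ ^ 3 / 2)
    (hlam : 4 * C1 * (p - 1) + 8 * N < c1 * p * (x₀ ^ 3 / 2) ^ (p - 1) * (3 * x₀ ^ 2) * lam)
    (hlam0 : 0 < lam)
    (hθ : 0 < θ) (hX : X = 1 - θ) (hYd : Y = X ^ 3 - δ * θ) (hY : 0 ≤ Y) (hQ1 : c1 ≤ Q)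
    (hQ2 : Q ≤ C1) (hG : 0 ≤ G) (hG2 : 1 / 2 ≤ θ → θ ^ 2 / 9 ≤ G) :
    Q * Y + (3 * X ^ 2 + δ) * (2 * N) * θ
      < Q * (p * Y ^ (p - 1) * (3 * X ^ 2 + δ) * lam * θ) + 6 * X * G + Q * Y ^ p := by
  have hQ0 : 0 < Q := hc1.trans_le hQ1
  have hδθ : 0 < δ * θ := mul_pos hδ hθ
  have hX3 : 0 < X ^ 3 := by linarith
  have hX0 : 0 < X := by
    by_contra hcon
    push Not at hcon
    have : X ^ 3 ≤ 0 := by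
      have := mul_nonneg (sq_nonneg X) (neg_nonneg.2 hcon)
      nlinarith
    linarith
  have hθ1 : θ < 1 := by linarith
  have hX1 : X < 1 := by linarith
  have hYp : 0 ≤ Y ^ p := rpow_nonneg hY _
  have hYp1 : 0 ≤ Y ^ (p - 1) := rpow_nonneg hY _
  rcases le_or_gt x₀ X with h | h
  · have hx3 : x₀ ^ 3 ≤ X ^ 3 := by gcongr
    have hx31 : x₀ ^ 3 ≤ 1 := pow_le_one₀ hx₀.le (by linarith)
    have hδθ' : δ * θ ≤ δ := by nlinarith
    have hY0 : x₀ ^ 3 / 2 ≤ Y := by linarith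
    have hY1 : Y ^ p ≥ 1 + p * (Y - 1) := by
      have := one_add_mul_self_le_rpow_one_add (s := Y - 1) (by linarith) hp.le
      rwa [show 1 + (Y - 1) = Y by ring] at this
    have h1Y : 1 - Y ≤ 4 * θ := by
      have : X ^ 3 = 1 - 3 * θ + 3 * θ ^ 2 - θ ^ 3 := by rw [hX]; ring
      have : θ ^ 3 ≤ θ ^ 2 := by nlinarith [sq_nonneg θ]
      nlinarith [sq_nonneg θ]
    have hpow : (x₀ ^ 3 / 2) ^ (p - 1) ≤ Y ^ (p - 1) :=
      rpow_le_rpow (by positivity) hY0 (by linarith)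
    have hxx : x₀ ^ 2 ≤ X ^ 2 := by gcongr
    have hlo : c1 * p * (x₀ ^ 3 / 2) ^ (p - 1) * (3 * x₀ ^ 2) * lam * θ
        ≤ Q * (p * Y ^ (p - 1) * (3 * X ^ 2 + δ) * lam * θ) := by
      have h1 : 3 * x₀ ^ 2 ≤ 3 * X ^ 2 + δ := by linarith
      calc c1 * p * (x₀ ^ 3 / 2) ^ (p - 1) * (3 * x₀ ^ 2) * lam * θ
          ≤ Q * p * Y ^ (p - 1) * (3 * X ^ 2 + δ) * lam * θ := by gcongr
        _ = _ := by ring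
    have hlo2 := mul_lt_mul_of_pos_right hlam hθ
    have h2 : 3 * X ^ 2 + δ ≤ 4 := by nlinarith
    have h3 : (3 * X ^ 2 + δ) * (2 * N) * θ ≤ 4 * (2 * N) * θ := by gcongr
    have h4 : Q * (Y - Y ^ p) ≤ C1 * ((p - 1) * (4 * θ)) := by
      have h5 : Y - Y ^ p ≤ (p - 1) * (4 * θ) := by
        have := mul_le_mul_of_nonneg_left h1Y (show 0 ≤ p - 1 by linarith)
        linarith
      have h6 : 0 ≤ (p - 1) * (4 * θ) := mul_nonneg (by linarith) (by linarith)
      exact (mul_le_mul_of_nonneg_left h5 hQ0.le).trans (mul_le_mul_of_nonneg_right hQ2 h6)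
    have h5 : 0 ≤ X * G := by positivity
    clear hlam hY1 h1Y hpow hxx
    linarith
  · have hθ2 : 1 / 2 ≤ θ := by linarith
    have hG' := hG2 hθ2
    have hδ2 : δ ≤ 2 * X ^ 3 := by
      have := mul_le_mul_of_nonneg_left hθ2 hδ.le
      linarith
    have hδ3 : δ ≤ X ^ 2 := by
      have := mul_le_mul_of_nonneg_left (show X ≤ 1 / 2 by linarith) (sq_nonneg X)
      linarith
    have h1 : X * θ / 3 ≤ 6 * X * G := by
      have h0 := mul_le_mul_of_nonneg_left hθ2 hθ.le
      have h1 : θ / 18 ≤ G := by linarith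
      have := mul_le_mul_of_nonneg_left h1 hX0.le
      linarith
    have hX3' : X ^ 3 ≤ X ^ 2 * θ := by
      have := mul_le_mul_of_nonneg_left (show X ≤ θ by linarith) (sq_nonneg X)
      linarith
    have h2 : Q * Y ≤ C1 * (X ^ 2 * θ) := by
      calc Q * Y ≤ C1 * Y := by gcongr
        _ ≤ C1 * (X ^ 2 * θ) := by
          apply mul_le_mul_of_nonneg_left _ hC1.le
          linarith
    have h3 : (3 * X ^ 2 + δ) * (2 * N) * θ ≤ (4 * X ^ 2) * (2 * N) * θ := by
      have : 3 * X ^ 2 + δ ≤ 4 * X ^ 2 := by linarith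
      gcongr
    have h4 : X * (C1 + 8 * N) ≤ 1 / 4 := by
      have : X * (C1 + 8 * N) ≤ x₀ * (C1 + 8 * N) := by gcongr
      linarith
    have hXθ : 0 < X * θ := by positivity
    have h5 : X * θ * (X * (C1 + 8 * N)) ≤ X * θ * (1 / 4) := by gcongr
    have h6 : 0 ≤ Q * (p * Y ^ (p - 1) * (3 * X ^ 2 + δ) * lam * θ) := by positivity
    have h7 : 0 ≤ Q * Y ^ p := by positivity
    linarith

theorem rr_barA {n : ℕ} {p ν L : ℝ} (P : RRPar n p ν L) {φ φ1 φ2 : ℝ → ℝ}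
    (S : RRSteady n p φ φ1 φ2) (α : ℝ) (hφα : ∀ r > (0:ℝ), φ r ≤ α)
    (hanti : ∀ r > (0:ℝ), ∀ s ≥ r, φ s ≤ φ r) (hφ1 : ∀ r > (0:ℝ), φ1 r ≤ 0) :
    ∃ c, 0 < c ∧ c ≤ 1 ∧ ∀ r > (0:ℝ),
      φ r * (2 * n - ((n:ℝ) - 3) * c / r ^ 3) + 2 * φ1 r * (2 * r - c / r ^ 2)
        ≤ 2 * n * φ r := by
  have hn := P.hn
  have hlow := rr_phi1_lower P S α hφα
  have hα : 0 < α := (S.pos 1 one_pos).trans_le (hφα 1 one_pos)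
  obtain ⟨C, hC⟩ : ∃ C, C = α ^ p / n := ⟨_, rfl⟩
  have hC0 : 0 < C := by rw [hC]; positivity
  rw [← hC] at hlow
  have hf1 := S.pos 1 one_pos
  obtain ⟨d, hd⟩ : ∃ d, d = min 1 (4 * φ 1 / C) := ⟨_, rfl⟩
  have hd0 : 0 < d := by rw [hd]; apply lt_min one_pos; positivity
  have hd1 : d ≤ 1 := by rw [hd]; exact min_le_left _ _
  have hd2 : C * d ≤ 4 * φ 1 := by
    have : d ≤ 4 * φ 1 / C := by rw [hd]; exact min_le_right _ _
    rw [le_div_iff₀ hC0] at this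
    linarith
  refine ⟨d ^ 3, by positivity, pow_le_one₀ hd0.le hd1, ?_⟩
  intro r hr
  have hφ := S.pos r hr
  have h1 : 0 < φ r * (((n:ℝ) - 3) * d ^ 3 / r ^ 3) := by
    have : 0 < (n:ℝ) - 3 := by linarith
    positivity
  rcases le_or_gt 0 (2 * r - d ^ 3 / r ^ 2) with h | h
  · have := mul_nonpos_of_nonpos_of_nonneg (hφ1 r hr) h
    linarith
  · have hrd : r < d := by
      have h2 : 2 * r < d ^ 3 / r ^ 2 := by linarith
      rw [lt_div_iff₀ (by positivity)] at h2
      by_contra hcon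
      push Not at hcon
      have : d ^ 3 ≤ r ^ 3 := by gcongr
      have : 0 < r ^ 3 := by positivity
      nlinarith
    have hφr := hanti r hr 1 (hrd.le.trans hd1)
    have hq : 0 < d ^ 3 / r ^ 2 := by positivity
    have h2 : φ1 r * (2 * r - d ^ 3 / r ^ 2) ≤ C * r * (d ^ 3 / r ^ 2) := by
      have e1 : φ1 r * (2 * r - d ^ 3 / r ^ 2) ≤ φ1 r * (- (d ^ 3 / r ^ 2)) :=
        mul_le_mul_of_nonpos_left (by linarith) (hφ1 r hr)
      have e2 := mul_le_mul_of_nonneg_right (hlow r hr) hq.le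
      linarith
    have h3 : 2 * (C * r * (d ^ 3 / r ^ 2)) ≤ φ r * (((n:ℝ) - 3) * d ^ 3 / r ^ 3) := by
      have e : 2 * (C * r * (d ^ 3 / r ^ 2)) = (2 * C * r ^ 2) * (d ^ 3 / r ^ 3) := by
        field_simp
      have e' : φ r * (((n:ℝ) - 3) * d ^ 3 / r ^ 3) = (φ r * ((n:ℝ) - 3)) * (d ^ 3 / r ^ 3) := by
        ring
      rw [e, e']
      apply mul_le_mul_of_nonneg_right _ (by positivity)
      have h4 : C * r ^ 2 ≤ C * d := by
        apply mul_le_mul_of_nonneg_left _ hC0.le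
        nlinarith
      have h5 : φ r * 8 ≤ φ r * ((n:ℝ) - 3) := mul_le_mul_of_nonneg_left (by linarith) hφ.le
      linarith
    linarith

theorem rr_P_bounds {n : ℕ} {p ν L : ℝ} (P : RRPar n p ν L) {φ φ1 φ2 : ℝ → ℝ}
    (S : RRSteady n p φ φ1 φ2) (α R₀ : ℝ) (hR₀ : 0 < R₀) (hφα : ∀ r > (0:ℝ), φ r ≤ α)
    (hφs : ∀ r > (0:ℝ), φ r ≤ L * r ^ (-ν))
    (hanti : ∀ r > (0:ℝ), ∀ s ≥ r, φ s ≤ φ r)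
    (hlo : ∀ r ≥ R₀, L / 2 * r ^ (-ν) ≤ φ r) :
    ∃ c1 C1 : ℝ, 0 < c1 ∧ 0 < C1 ∧ ∀ r > (0:ℝ),
      c1 ≤ (1 + r ^ 2) * φ r ^ (p - 1) ∧ (1 + r ^ 2) * φ r ^ (p - 1) ≤ C1 := by
  have hp := P.hp
  have hL := P.L_pos
  have hα : 0 < α := (S.pos 1 one_pos).trans_le (hφα 1 one_pos)
  have hR := S.pos R₀ hR₀
  have hid : ∀ r > (0:ℝ), r ^ 2 * r ^ (-2:ℝ) = 1 := by
    intro r hr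
    rw [rpow_neg hr.le, rpow_two]; field_simp
  refine ⟨min (φ R₀ ^ (p - 1)) ((L / 2) ^ (p - 1)), α ^ (p - 1) + L ^ (p - 1),
    lt_min (by positivity) (by positivity), by positivity, ?_⟩
  intro r hr
  have hφ := S.pos r hr
  have hφp : 0 < φ r ^ (p - 1) := by positivity
  constructor
  · rcases le_total r R₀ with h | h
    · have h1 : φ R₀ ^ (p - 1) ≤ φ r ^ (p - 1) :=
        rpow_le_rpow hR.le (hanti r hr R₀ h) (by linarith)
      have h2 : 0 ≤ r ^ 2 * φ r ^ (p - 1) := by positivity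
      linarith [min_le_left (φ R₀ ^ (p - 1)) ((L / 2) ^ (p - 1))]
    · have h1 : (L / 2 * r ^ (-ν)) ^ (p - 1) ≤ φ r ^ (p - 1) :=
        rpow_le_rpow (by positivity) (hlo r h) (by linarith)
      have h2 : (L / 2 * r ^ (-ν)) ^ (p - 1) = (L / 2) ^ (p - 1) * r ^ (-2:ℝ) := by
        rw [mul_rpow (by positivity) (rpow_pos_of_pos hr _).le, ← rpow_mul hr.le]
        congr 2; linarith [P.νp]
      rw [h2] at h1
      have h3 := mul_le_mul_of_nonneg_left h1 (sq_nonneg r)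
      have h4 := hid r hr
      have h5 : r ^ 2 * ((L / 2) ^ (p - 1) * r ^ (-2:ℝ)) = (L / 2) ^ (p - 1) := by
        linear_combination (L / 2) ^ (p - 1) * h4
      linarith [min_le_right (φ R₀ ^ (p - 1)) ((L / 2) ^ (p - 1))]
  · have h1 : φ r ^ (p - 1) ≤ α ^ (p - 1) := rpow_le_rpow hφ.le (hφα r hr) (by linarith)
    have h2 : φ r ^ (p - 1) ≤ L ^ (p - 1) * r ^ (-2:ℝ) := by
      rw [← rr_sp1 P hr]; exact rpow_le_rpow hφ.le (hφs r hr) (by linarith)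
    have h3 := mul_le_mul_of_nonneg_left h2 (sq_nonneg r)
    have h4 := hid r hr
    have h5 : r ^ 2 * (L ^ (p - 1) * r ^ (-2:ℝ)) = L ^ (p - 1) := by
      linear_combination L ^ (p - 1) * h4
    linarith

set_option maxHeartbeats 1000000 in
theorem rr_step4 {n : ℕ} {p ν L : ℝ} (P : RRPar n p ν L) {v : ℝ → ℝ → ℝ} {v₀ : ℝ → ℝ}
    (hv : IsRadialSol n p v v₀) {φ φ1 φ2 : ℝ → ℝ}
    (S : RRSteady n p φ φ1 φ2) (α R₀ : ℝ) (hR₀ : 0 < R₀) (hφα : ∀ r > (0:ℝ), φ r ≤ α)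
    (hφs : ∀ r > (0:ℝ), φ r ≤ L * r ^ (-ν))
    (hanti : ∀ r > (0:ℝ), ∀ s ≥ r, φ s ≤ φ r) (hφ1 : ∀ r > (0:ℝ), φ1 r ≤ 0)
    (hlo : ∀ r ≥ R₀, L / 2 * r ^ (-ν) ≤ φ r) (h0 : ∀ r > (0:ℝ), φ r ≤ v₀ r) :
    ∀ r > (0:ℝ), ∀ t ≥ (0:ℝ), φ r ≤ v r t := by
  have hp := P.hp
  have hn := P.hn
  obtain ⟨c, hc0, hc1, hA⟩ := rr_barA P S α hφα hanti hφ1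
  obtain ⟨c1, C1, hc10, hC10, hPb⟩ := rr_P_bounds P S α R₀ hR₀ hφα hφs hanti hlo
  intro r₁ hr₁ t₁ ht₁
  obtain ⟨x₀, hx₀⟩ : ∃ x₀, x₀ = min (1 / 2) (1 / 4 / (C1 + 8 * (n:ℝ))) := ⟨_, rfl⟩
  have hx0 : 0 < x₀ := by rw [hx₀]; apply lt_min (by norm_num); positivity
  have hx1 : x₀ ≤ 1 / 2 := by rw [hx₀]; exact min_le_left _ _
  have hx2 : x₀ * (C1 + 8 * (n:ℝ)) ≤ 1 / 4 := by
    have : x₀ ≤ 1 / 4 / (C1 + 8 * (n:ℝ)) := by rw [hx₀]; exact min_le_right _ _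
    rwa [le_div_iff₀ (by positivity)] at this
  obtain ⟨δ, hδ⟩ : ∃ δ, δ = x₀ ^ 3 / 2 := ⟨_, rfl⟩
  have hδ0 : 0 < δ := by rw [hδ]; positivity
  obtain ⟨Z, hZ⟩ : ∃ Z, Z = c1 * p * (x₀ ^ 3 / 2) ^ (p - 1) * (3 * x₀ ^ 2) := ⟨_, rfl⟩
  have hZ0 : 0 < Z := by rw [hZ]; positivity
  obtain ⟨lam, hlam⟩ : ∃ lam, lam = (4 * C1 * (p - 1) + 8 * (n:ℝ) + 1) / Z := ⟨_, rfl⟩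
  have hp1 : 0 < p - 1 := by linarith
  have hlam0 : 0 < lam := by rw [hlam]; positivity
  have hlamZ : 4 * C1 * (p - 1) + 8 * (n:ℝ) < Z * lam := by
    rw [hlam, mul_div_cancel₀ _ hZ0.ne']; linarith
  rw [hZ] at hlamZ
  obtain ⟨A, hAd⟩ : ∃ A : ℝ → ℝ, A = fun r => 1 + r ^ 2 + c / r := ⟨_, rfl⟩
  have hA1 : ∀ r > (0:ℝ), 1 + r ^ 2 ≤ A r := by
    intro r hr
    have : 0 < c / r := by positivity
    rw [hAd]; simp only; linarith
  have hApos : ∀ r > (0:ℝ), 0 < A r := fun r hr =>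
    lt_of_lt_of_le (by positivity) (hA1 r hr)
  have hAd1 : ∀ r > (0:ℝ), HasDerivAt A (2 * r - c / r ^ 2) r := by
    intro r hr
    rw [hAd]
    have h1 := ((hasDerivAt_pow 2 r).const_add 1).add ((hasDerivAt_inv hr.ne').const_mul c)
    have h2 : (fun r : ℝ => 1 + r ^ 2 + c / r) = fun r => (1 + r ^ 2) + c * r⁻¹ := by
      ext x; rw [div_eq_mul_inv]
    rw [h2]
    refine h1.congr_deriv ?_
    norm_num; ring
  have hAd2 : ∀ r > (0:ℝ), HasDerivAt (fun r => 2 * r - c / r ^ 2) (2 + 2 * c / r ^ 3) r := by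
    intro r hr
    have h1 := ((hasDerivAt_id r).const_mul 2).sub
      ((((hasDerivAt_pow 2 r).inv (by positivity)).const_mul c))
    refine h1.congr_deriv ?_
    norm_num
    field_simp
    ring
  -- main claim for small ε
  have main : ∀ ε : ℝ, 0 < ε → ε * exp (lam * (t₁ + 1)) ≤ 1 / 16 →
      φ r₁ * ((1 - ε * exp (lam * t₁) * A r₁) ^ 3 - δ * (ε * exp (lam * t₁) * A r₁))
        ≤ v r₁ t₁ := by
    intro ε hε hεs
    obtain ⟨ρ, hρ, hρr, hρM⟩ := rr_near0 (a := 1) (c := ε * c) one_pos (by positivity) 1 r₁ hr₁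
    obtain ⟨R, hR⟩ : ∃ R, R = max r₁ (max 1 (1 / ε)) := ⟨_, rfl⟩
    have hRr : r₁ ≤ R := by rw [hR]; exact le_max_left _ _
    have hR1 : 1 ≤ R := by rw [hR]; exact (le_max_left _ _).trans (le_max_right _ _)
    have hRε : 1 / ε ≤ R := by rw [hR]; exact (le_max_right _ _).trans (le_max_right _ _)
    have hR0 : 0 < R := by linarith
    have hAρ : 1 < ε * A ρ := by
      rw [rpow_neg_one] at hρM
      have : ε * A ρ = ε * (1 + ρ ^ 2) + ε * c * ρ⁻¹ := by
        rw [hAd]; simp only; rw [div_eq_mul_inv]; ring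
      have : 0 < ε * (1 + ρ ^ 2) := by positivity
      linarith
    have hAR : 1 < ε * A R := by
      have h1 := hA1 R hR0
      rw [div_le_iff₀ hε] at hRε
      have h2 : ε * (1 + R ^ 2) ≤ ε * A R := mul_le_mul_of_nonneg_left h1 hε.le
      nlinarith
    have hside : ∀ x > (0:ℝ), 1 < ε * A x → ∀ t ≥ (0:ℝ),
        φ x * ((1 - ε * exp (lam * t) * A x) ^ 3 - δ * (ε * exp (lam * t) * A x)) < 0 := by
      intro x hx h1 t ht
      have h2 : 1 ≤ exp (lam * t) := one_le_exp (mul_nonneg hlam0.le ht)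
      have h3 : 1 < ε * exp (lam * t) * A x := by
        have : ε * exp (lam * t) * A x = exp (lam * t) * (ε * A x) := by ring
        rw [this]; nlinarith
      set θ := ε * exp (lam * t) * A x
      apply mul_neg_of_pos_of_neg (S.pos x hx)
      have h4 : (1 - θ) ^ 3 < 0 := Odd.pow_neg (by decide) (by linarith)
      have h5 : 0 < δ * θ := mul_pos hδ0 (by linarith)
      linarith
    have hmono3 : ∀ x y : ℝ, x ≤ y → x ^ 3 ≤ y ^ 3 := fun x y h =>
      (Odd.strictMono_pow (by decide : Odd 3)).monotone h
    refine (rr_lower hp hv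
      (fun r t => φ r * ((1 - ε * exp (lam * t) * A r) ^ 3 - δ * (ε * exp (lam * t) * A r)))
      (fun r t => φ1 r * ((1 - ε * exp (lam * t) * A r) ^ 3 - δ * (ε * exp (lam * t) * A r))
        + φ r * (-((3 * (1 - ε * exp (lam * t) * A r) ^ 2 + δ)
          * (ε * exp (lam * t) * (2 * r - c / r ^ 2)))))
      (fun r t => φ2 r * ((1 - ε * exp (lam * t) * A r) ^ 3 - δ * (ε * exp (lam * t) * A r))
        + 2 * φ1 r * (-((3 * (1 - ε * exp (lam * t) * A r) ^ 2 + δ)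
          * (ε * exp (lam * t) * (2 * r - c / r ^ 2))))
        + φ r * (-((3 * (1 - ε * exp (lam * t) * A r) ^ 2 + δ)
          * (ε * exp (lam * t) * (2 + 2 * c / r ^ 3)))
          + 6 * (1 - ε * exp (lam * t) * A r) * (ε * exp (lam * t) * (2 * r - c / r ^ 2)) ^ 2))
      (fun r t => φ r * (-((3 * (1 - ε * exp (lam * t) * A r) ^ 2 + δ)
          * (lam * (ε * exp (lam * t) * A r)))))
      ρ R 0 (t₁ + 1) hρ le_rfl ?_ ?_ ?_ ?_ ?_ ?_ ?_ ?_ r₁ ⟨hρr, hRr⟩ t₁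
      ⟨ht₁, by linarith⟩).le
    · have e1 : ContinuousOn (fun q : ℝ × ℝ => φ q.1) (Icc ρ R ×ˢ Icc 0 (t₁ + 1)) := by
        have h1 : ContinuousOn φ (Icc ρ R) := fun x hx =>
          ((S.c2 x (hρ.trans_le hx.1)).1.continuousAt).continuousWithinAt
        exact h1.comp continuousOn_fst (fun q hq => hq.1)
      have e2 : ContinuousOn (fun q : ℝ × ℝ => A q.1) (Icc ρ R ×ˢ Icc 0 (t₁ + 1)) := by
        have h1 : ContinuousOn A (Icc ρ R) := fun x hx =>
          ((hAd1 x (hρ.trans_le hx.1)).continuousAt).continuousWithinAt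
        exact h1.comp continuousOn_fst (fun q hq => hq.1)
      have e3 : ContinuousOn (fun q : ℝ × ℝ => ε * exp (lam * q.2) * A q.1)
          (Icc ρ R ×ˢ Icc 0 (t₁ + 1)) :=
        (Continuous.continuousOn (by fun_prop)).mul e2
      exact e1.mul (((continuousOn_const.sub e3).pow 3).sub (continuousOn_const.mul e3))
    · intro t ht r hr
      have ha := hAd1 r hr
      have ha2 := hAd2 r hr
      have hf := S.c2 r hr
      have hθ := ha.const_mul (ε * exp (lam * t))
      have hY : HasDerivAt (fun r => (1 - ε * exp (lam * t) * A r) ^ 3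
          - δ * (ε * exp (lam * t) * A r))
          (-((3 * (1 - ε * exp (lam * t) * A r) ^ 2 + δ)
          * (ε * exp (lam * t) * (2 * r - c / r ^ 2)))) r := by
        refine (((hθ.const_sub 1).pow 3).sub (hθ.const_mul δ)).congr_deriv ?_
        norm_num; ring
      have hY2 : HasDerivAt (fun r => -((3 * (1 - ε * exp (lam * t) * A r) ^ 2 + δ)
          * (ε * exp (lam * t) * (2 * r - c / r ^ 2))))
          (-((3 * (1 - ε * exp (lam * t) * A r) ^ 2 + δ)
          * (ε * exp (lam * t) * (2 + 2 * c / r ^ 3)))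
          + 6 * (1 - ε * exp (lam * t) * A r)
            * (ε * exp (lam * t) * (2 * r - c / r ^ 2)) ^ 2) r := by
        refine ((((((hθ.const_sub 1).pow 2).const_mul 3).add_const δ).mul
          (ha2.const_mul (ε * exp (lam * t)))).neg).congr_deriv ?_
        norm_num; ring
      refine ⟨hf.1.mul hY, ((hf.2.mul hY).add (hf.1.mul hY2)).congr_deriv ?_⟩
      ring
    · intro r hr t ht
      have hE : HasDerivAt (fun s => exp (lam * s)) (lam * exp (lam * t)) t := by
        have := ((hasDerivAt_id t).const_mul lam).exp
        simpa [mul_comm] using this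
      have hθ := (hE.const_mul ε).mul_const (A r)
      refine ((((hθ.const_sub 1).pow 3).sub (hθ.const_mul δ)).const_mul (φ r)).congr_deriv ?_
      norm_num; ring
    · intro r hr s t hst
      have h1 : exp (lam * s) ≤ exp (lam * t) :=
        exp_le_exp.2 (mul_le_mul_of_nonneg_left hst hlam0.le)
      have h2 : ε * exp (lam * s) * A r ≤ ε * exp (lam * t) * A r := by
        have := hApos r hr
        gcongr
      apply mul_le_mul_of_nonneg_left _ (S.pos r hr).le
      have h3 := hmono3 (1 - ε * exp (lam * t) * A r) (1 - ε * exp (lam * s) * A r) (by linarith)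
      have h4 := mul_le_mul_of_nonneg_left h2 hδ0.le
      linarith
    · intro r hr
      have hr0 : 0 < r := hρ.trans_le hr.1
      rw [hv.init r hr0.le]
      refine lt_of_lt_of_le ?_ (h0 r hr0)
      have hθ : 0 < ε * exp (lam * 0) * A r := by
        have := hApos r hr0
        positivity
      set θ := ε * exp (lam * 0) * A r
      have h1 := hmono3 (1 - θ) 1 (by linarith)
      have h2 : 0 < δ * θ := mul_pos hδ0 hθ
      have h3 := S.pos r hr0
      nlinarith
    · intro t ht
      exact (hside ρ hρ hAρ t ht.1).trans_le (hv.nonneg ρ hρ.le t ht.1)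
    · intro t ht
      exact (hside R hR0 hAR t ht.1).trans_le (hv.nonneg R hR0.le t ht.1)
    · intro r hr t ht hV
      have hr0 : 0 < r := hρ.trans hr.1
      have hφ := S.pos r hr0
      set e := ε * exp (lam * t) with he
      have he0 : 0 < e := by positivity
      have he1 : e ≤ 1 / 16 := by
        refine le_trans ?_ hεs
        rw [he]
        apply mul_le_mul_of_nonneg_left _ hε.le
        exact exp_le_exp.2 (mul_le_mul_of_nonneg_left ht.2 hlam0.le)
      have hAr := hApos r hr0
      have hA1r := hA1 r hr0
      have hArd : A r = 1 + r ^ 2 + c / r := by rw [hAd]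
      have hgeo := rr_geo hc0 hc1 hr0 he0 he1
      rw [← hArd] at hgeo
      set θ := e * A r with hθ
      have hθ0 : 0 < θ := by positivity
      set A1 := 2 * r - c / r ^ 2 with hA1d
      set X := 1 - θ with hX
      obtain ⟨Y, hY⟩ : ∃ Y, Y = X ^ 3 - δ * θ := ⟨_, rfl⟩
      rw [← hY] at hV ⊢
      have hY0 : 0 ≤ Y := nonneg_of_mul_nonneg_right hV hφ
      have hb := hPb r hr0
      set F := φ r ^ (p - 1) with hF
      have hF0 : 0 < F := by positivity
      have hsc := rr_scalar (p := p) (N := n) hp (by positivity) hc10 hC10 hx0 hx1 hx2 hδ0 hδ.le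
        hlamZ hlam0 hθ0 hX hY hY0 hb.1 hb.2
        (G := (1 + r ^ 2) * (e * A1) ^ 2) (by positivity) hgeo
      have hAA := hA r hr0
      rw [← hA1d] at hAA
      have hode := S.ode r hr0
      have hφp : φ r ^ p = F * φ r := by
        rw [hF, ← rpow_add_one hφ.ne']; congr 1; ring
      have hVp : (φ r * Y) ^ p = F * φ r * Y ^ p := by
        rw [mul_rpow hφ.le hY0, hφp]
      have hVp1 : (φ r * Y) ^ (p - 1) = F * Y ^ (p - 1) := by
        rw [mul_rpow hφ.le hY0]
      rw [hVp, hVp1]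
      rw [hφp] at hode
      set W := Y ^ (p - 1) with hW
      set U := Y ^ p with hU
      set T3 := 3 * X ^ 2 + δ with hT3
      have hT0 : 0 < T3 := by positivity
      -- divide the scalar inequality by 1 + r^2
      have hq : 0 < 1 + r ^ 2 := by positivity
      have heq : e * (1 + r ^ 2) ≤ θ := by
        rw [hθ]; exact mul_le_mul_of_nonneg_left hA1r he0.le
      have hsc2 : F * Y + T3 * (2 * n) * e
          < F * (p * W * T3 * lam * θ) + 6 * X * (e * A1) ^ 2 + F * U := by
        have h1 : T3 * (2 * n) * (e * (1 + r ^ 2)) ≤ T3 * (2 * n) * θ :=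
          mul_le_mul_of_nonneg_left heq (by positivity)
        have h2 : (1 + r ^ 2) * (F * Y + T3 * (2 * n) * e) < (1 + r ^ 2) *
            (F * (p * W * T3 * lam * θ) + 6 * X * (e * A1) ^ 2 + F * U) := by
          linarith only [hsc, h1]
        exact lt_of_mul_lt_mul_left h2 hq.le
      have hsc3 := mul_lt_mul_of_pos_left hsc2 hφ
      have hAA2 := mul_le_mul_of_nonneg_left hAA (show 0 ≤ T3 * e by positivity)
      have hlapA : (2 + 2 * c / r ^ 3) + ((n:ℝ) - 1) / r * A1 = 2 * n - ((n:ℝ) - 3) * c / r ^ 3 := by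
        rw [hA1d]; field_simp; ring
      rw [← hlapA] at hAA2
      have hφ2 : φ2 r = -(F * φ r) - ((n:ℝ) - 1) / r * φ1 r := by linear_combination hode
      rw [hφ2]
      set D := ((n:ℝ) - 1) / r with hD
      clear_value D T3 U W F X A1 θ e
      linarith only [hsc3, hAA2]
  have hcont : Tendsto (fun ε : ℝ => φ r₁ * ((1 - ε * exp (lam * t₁) * A r₁) ^ 3
      - δ * (ε * exp (lam * t₁) * A r₁))) (nhdsWithin 0 (Ioi 0)) (nhds (φ r₁)) := by
    have h1 : Continuous (fun ε : ℝ => φ r₁ * ((1 - ε * exp (lam * t₁) * A r₁) ^ 3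
      - δ * (ε * exp (lam * t₁) * A r₁))) := by fun_prop
    have h2 := h1.tendsto 0
    simp only [zero_mul, mul_zero, sub_zero, one_pow, mul_one] at h2
    exact h2.mono_left nhdsWithin_le_nhds
  apply le_of_tendsto hcont
  have hE := exp_pos (lam * (t₁ + 1))
  filter_upwards [Ioo_mem_nhdsGT (show (0:ℝ) < 1 / 16 / exp (lam * (t₁ + 1)) by positivity)]
    with ε hε
  apply main ε hε.1
  exact ((lt_div_iff₀ hE).1 hε.2).le

theorem rr_par (n : ℕ) (hn : 10 < n) (p : ℝ) (hp : pc n < p) :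
    RRPar n p (nuExp p) (Lconst n p) := by
  have hn' : (11:ℝ) ≤ n := by exact_mod_cast hn
  have h2 : 0 < (n:ℝ) - 2 := by linarith
  have h10 : 0 < (n:ℝ) - 10 := by linarith
  have hpc : ((n:ℝ) + 2) / ((n:ℝ) - 2) ≤ pc n := by
    unfold pc
    rw [div_le_div_iff₀ h2 (mul_pos h2 h10)]
    have hs := Real.sqrt_nonneg ((n:ℝ) - 1)
    have h3 : ((n:ℝ) + 2) * ((n:ℝ) - 10) ≤
      ((n:ℝ) - 2) ^ 2 - 4 * (n : ℝ) + 8 * Real.sqrt ((n : ℝ) - 1) := by nlinarith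
    have := mul_le_mul_of_nonneg_right h3 h2.le
    linarith
  have hp' := hpc.trans_lt hp
  rw [div_lt_iff₀ h2] at hp'
  have hp1 : 1 < p := by
    by_contra hcon
    push Not at hcon
    nlinarith
  have hp0 : 0 < p - 1 := by linarith
  have hν : 0 < nuExp p := by unfold nuExp; positivity
  have hνlt : nuExp p < ((n:ℝ) - 2) / 2 := by
    unfold nuExp
    rw [div_lt_div_iff₀ hp0 two_pos]
    linarith
  have hpos : 0 < nuExp p * ((n:ℝ) - 2 - nuExp p) := mul_pos hν (by linarith)
  refine ⟨hp1, hn', hν, ?_, hνlt, ?_, ?_⟩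
  · unfold nuExp; field_simp
  · unfold Lconst; exact rpow_pos_of_pos hpos _
  · unfold Lconst
    rw [← rpow_mul hpos.le, one_div, inv_mul_cancel₀ hp0.ne', rpow_one]

theorem rr_lam1_pos {n : ℕ} {p L : ℝ} (P : RRPar n p (nuExp p) L) : 0 < lam1 n p := by
  have h1 := P.ν_lt
  have h2 := P.ν_pos
  have hm : 0 < (n:ℝ) - 2 - 2 * nuExp p := by linarith
  unfold lam1
  have : Real.sqrt (((n : ℝ) - 2 - 2 * nuExp p) ^ 2 - 8 * ((n : ℝ) - 2 - nuExp p))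
      < (n:ℝ) - 2 - 2 * nuExp p := by
    rw [Real.sqrt_lt' hm]
    linarith
  linarith

theorem rr_steady {n : ℕ} {p α a : ℝ} {φ : ℝ → ℝ} (hφ : IsSteadyStateA n p α φ a) :
    RRSteady n p φ (deriv φ) (deriv (deriv φ)) := by
  refine ⟨?_, fun r hr => hφ.pos r hr.le, fun r hr => by linarith [hφ.ode r hr]⟩
  intro r hr
  have h1 := (contDiffOn_succ_iff_deriv_of_isOpen (n := 1) isOpen_Ioi).1
    (by rw [one_add_one_eq_two]; exact hφ.smooth)
  refine ⟨(h1.1.differentiableAt (Ioi_mem_nhds hr)).hasDerivAt, ?_⟩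
  exact ((h1.2.2.differentiableOn (by norm_num)).differentiableAt (Ioi_mem_nhds hr)).hasDerivAt

theorem rr_phi1_nonpos {φ φ1 : ℝ → ℝ} (hd : ∀ r > (0:ℝ), HasDerivAt φ (φ1 r) r)
    (hanti : ∀ r > (0:ℝ), ∀ s ≥ r, φ s ≤ φ r) : ∀ r > (0:ℝ), φ1 r ≤ 0 := by
  intro r hr
  have h1 := (hasDerivAt_iff_tendsto_slope.1 (hd r hr)).mono_left
    (nhdsWithin_mono r (fun s (hs : s ∈ Ioi r) => (ne_of_gt hs : s ≠ r)))
  apply le_of_tendsto h1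
  filter_upwards [self_mem_nhdsWithin] with s hs
  have hs' : r < s := hs
  rw [slope_def_field]
  exact div_nonpos_of_nonpos_of_nonneg (by linarith [hanti r hr s hs'.le]) (by linarith)

theorem rr_final {n : ℕ} {p ν L : ℝ} (P : RRPar n p ν L) (α b γ κ l a : ℝ)
    (hb : 0 < b) (hl : 0 < l) (hγ : ν + l < γ) (hγ2 : γ < (n:ℝ) - 2)
    (hκ : (1 + κ) * (p * L ^ (p - 1)) = γ * ((n:ℝ) - 2 - γ)) (ha : 0 < a)
    {φ φ1 φ2 : ℝ → ℝ} (S : RRSteady n p φ φ1 φ2) (hφc : ContinuousOn φ (Ici 0))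
    (hanti : ∀ r > (0:ℝ), ∀ s ≥ r, φ s ≤ φ r) (hφα : ∀ r > (0:ℝ), φ r ≤ α)
    (hφs : ∀ r > (0:ℝ), φ r ≤ L * r ^ (-ν))
    (hexp : (fun r => φ r - (L * r ^ (-ν) - a * r ^ (-ν - l)))
      =o[atTop] fun r => r ^ (-ν - l))
    (v₀ : ℝ → ℝ) (hv₀cont : ContinuousOn v₀ (Set.Ici 0))
    (hv₀upper : ∀ r > (0 : ℝ), v₀ r ≤ L * r ^ (-ν))
    (hv₀ge : ∀ r ≥ (0 : ℝ), φ r ≤ v₀ r)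
    (hv₀close : ∀ r > (1 : ℝ), v₀ r ≤ φ r + b * r ^ (-γ)) :
    ∃ C > 0, ∀ v : ℝ → ℝ → ℝ, IsRadialSol n p v v₀ →
      ∀ r ≥ (0 : ℝ), ∀ t ≥ (0 : ℝ), |v r t - φ r| ≤ C * exp (-κ * t) := by
  have hp := P.hp
  have hn := P.hn
  have hL := P.L_pos
  have hν := P.ν_pos
  have hγ0 : 0 < γ := by linarith
  have hφ1 := rr_phi1_nonpos (fun r hr => (S.c2 r hr).1) hanti
  have hκ1 : 0 ≤ 1 + κ := by
    by_contra hcon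
    push Not at hcon
    have h1 : 0 < γ * ((n:ℝ) - 2 - γ) := mul_pos hγ0 (by linarith)
    have h2 : 0 < p * L ^ (p - 1) := by positivity
    nlinarith
  -- expansion
  have hev1 := hexp.def (half_pos ha)
  have hev2 : ∀ᶠ r : ℝ in atTop, 2 * a * r ^ (-l) < L / 2 := by
    have h1 := (tendsto_rpow_neg_atTop hl).const_mul (2 * a)
    rw [mul_zero] at h1
    exact h1.eventually_lt_const (half_pos hL)
  obtain ⟨R₀', hR₀'⟩ := eventually_atTop.1 (hev1.and hev2)
  obtain ⟨R₀, hR₀d⟩ : ∃ R₀, R₀ = max R₀' 1 := ⟨_, rfl⟩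
  have hR₀1 : 1 ≤ R₀ := by rw [hR₀d]; exact le_max_right _ _
  have hR₀R : R₀' ≤ R₀ := by rw [hR₀d]; exact le_max_left _ _
  have hR₀ : 0 < R₀ := by linarith
  have hboth : ∀ r ≥ R₀, |φ r - (L * r ^ (-ν) - a * r ^ (-ν - l))| ≤ a / 2 * r ^ (-ν - l) := by
    intro r hr
    have h1 := (hR₀' r (hR₀R.trans hr)).1
    have h2 : 0 < r ^ (-ν - l) := rpow_pos_of_pos (hR₀.trans_le hr) _
    rwa [Real.norm_eq_abs, Real.norm_eq_abs, abs_of_pos h2] at h1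
  have hlo : ∀ r ≥ R₀, L * r ^ (-ν) - 2 * a * r ^ (-ν - l) ≤ φ r := by
    intro r hr
    have h1 := (abs_le.1 (hboth r hr)).1
    have h2 : 0 < a * r ^ (-ν - l) := mul_pos ha (rpow_pos_of_pos (hR₀.trans_le hr) _)
    linarith
  have hup : ∀ r ≥ R₀, φ r ≤ L * r ^ (-ν) - a / 2 * r ^ (-ν - l) := by
    intro r hr
    have h1 := (abs_le.1 (hboth r hr)).2
    linarith
  have hlo2 : ∀ r ≥ R₀, L / 2 * r ^ (-ν) ≤ φ r := by
    intro r hr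
    have hr0 : 0 < r := hR₀.trans_le hr
    have h1 := hlo r hr
    have h2 := (hR₀' r (hR₀R.trans hr)).2
    have h3 : r ^ (-ν - l) = r ^ (-l) * r ^ (-ν) := by
      rw [← rpow_add hr0]; congr 1; ring
    have h4 := mul_le_mul_of_nonneg_right h2.le (rpow_pos_of_pos hr0 (-ν)).le
    rw [h3] at h1
    linarith
  -- constants
  obtain ⟨K0, hK0⟩ := (isCompact_Icc.image_of_continuousOn
    (hv₀cont.mono (Icc_subset_Ici_self : Icc (0:ℝ) 1 ⊆ Ici 0))).bddAbove
  obtain ⟨K, hKd⟩ : ∃ K, K = max K0 L + 1 := ⟨_, rfl⟩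
  have hKL : L < K := by rw [hKd]; linarith [le_max_right K0 L]
  have hKK : K0 ≤ K := by rw [hKd]; linarith [le_max_left K0 L]
  have hKpos : 0 < K := hL.trans hKL
  have hv₀K : ∀ r > (0:ℝ), v₀ r ≤ K := by
    intro r hr
    rcases le_total r 1 with h | h
    · exact (hK0 ⟨r, ⟨hr.le, h⟩, rfl⟩).trans hKK
    · have h1 := hv₀upper r hr
      have h2 : r ^ (-ν) ≤ 1 := rpow_le_one_of_one_le_of_nonpos h (by linarith)
      nlinarith
  obtain ⟨M, hMd⟩ : ∃ M, M = max b K := ⟨_, rfl⟩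
  have hMb : b ≤ M := by rw [hMd]; exact le_max_left _ _
  have hMK : K ≤ M := by rw [hMd]; exact le_max_right _ _
  have hM : 0 < M := hb.trans_le hMb
  have hv₀M : ∀ r > (0:ℝ), v₀ r ≤ φ r + M * r ^ (-γ) := by
    intro r hr
    have hq : 0 < r ^ (-γ) := rpow_pos_of_pos hr _
    rcases lt_or_ge 1 r with h | h
    · have h1 := hv₀close r h
      have := mul_le_mul_of_nonneg_right hMb hq.le
      linarith
    · have h1 : 1 ≤ r ^ (-γ) := one_le_rpow_of_pos_of_le_one_of_nonpos hr h (by linarith)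
      have h2 := hv₀K r hr
      have h3 := S.pos r hr
      nlinarith
  obtain ⟨β, hβ, h56⟩ := rr_step56 P S α a l R₀ M γ κ K ha hl hR₀ hM hγ hKpos hanti hφα hlo hup
  obtain ⟨B, hBd⟩ : ∃ B, B = (1 + κ) * p * β ^ (p - 1) / (2 * n) := ⟨_, rfl⟩
  have hB : 0 ≤ B := by rw [hBd]; positivity
  have hBβ : (1 + κ) * p * β ^ (p - 1) ≤ 2 * n * B := by
    rw [hBd, mul_div_cancel₀ _ (by positivity)]
  obtain ⟨R, hRd⟩ : ∃ R, R = 1 / (2 * (B + 1)) := ⟨_, rfl⟩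
  have hR : 0 < R := by rw [hRd]; positivity
  have hBR1 : B * R + R = 1 / 2 := by rw [hRd]; field_simp
  have hR1 : R ≤ 1 := by nlinarith [mul_nonneg hB hR.le]
  have hBR : B * R ^ 2 ≤ 1 / 2 := by nlinarith [mul_nonneg hB hR.le]
  have hRγ : 0 < R ^ (-γ) := rpow_pos_of_pos hR _
  obtain ⟨N, hNd⟩ : ∃ N, N = 2 * (M * R ^ (-γ) + β * exp κ) := ⟨_, rfl⟩
  have hN : 0 < N := by rw [hNd]; positivity
  have hNM : M * R ^ (-γ) ≤ N / 2 := by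
    have : 0 < β * exp κ := by positivity
    linarith
  have hNβ : β * exp κ ≤ N / 2 := by
    have : 0 < M * R ^ (-γ) := by positivity
    linarith
  refine ⟨N + K * exp 1 * exp |κ|, by positivity, ?_⟩
  intro v hv
  have hs := rr_step1 P hv hv₀upper
  have h2 := rr_step2 P hv hs K hKL hv₀K
  have h3 := rr_step3 P hv hs S M γ κ hM hγ0 hγ2 hκ hv₀M
  have h4 := rr_step4 P hv S α R₀ hR₀ hφα hφs hanti hφ1 hlo2 (fun r hr => hv₀ge r hr.le)
  have h6 := h56 v v₀ hv hs h2 h3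
  have h7 := rr_step7 P hv S 1 zero_le_one κ β B N R hκ1 hR hB hN hBR hBβ h6
    (by
      intro r hr _
      have e1 := h6 r hr 1 le_rfl
      have e2 := S.pos r hr
      have e3 := mul_le_mul_of_nonneg_right hNβ (exp_pos (-κ * 1)).le
      have e4 : β * exp κ * exp (-κ * 1) = β := by
        rw [mul_assoc, ← exp_add]; simp
      linarith)
    (by
      intro t ht
      have e1 := h3 R hR t (by linarith)
      have e2 := mul_le_mul_of_nonneg_right hNM (exp_pos (-κ * t)).le
      linarith)
  have hpos : ∀ r > (0:ℝ), ∀ t ≥ (0:ℝ),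
      |v r t - φ r| ≤ (N + K * exp 1 * exp |κ|) * exp (-κ * t) := by
    intro r hr t ht
    rw [abs_of_nonneg (by linarith [h4 r hr t ht])]
    have hE : 0 < exp (-κ * t) := exp_pos _
    have hNE : 0 < N * exp (-κ * t) := by positivity
    have hKE : 0 < K * exp 1 * exp |κ| * exp (-κ * t) := by positivity
    rcases le_total t 1 with h | h
    · have e1 := h2 r hr t ht
      have e2 := S.pos r hr
      have e3 : K * exp t ≤ K * exp 1 := mul_le_mul_of_nonneg_left (exp_le_exp.2 h) hKpos.le
      have e4 : 1 ≤ exp |κ| * exp (-κ * t) := by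
        rw [← exp_add]
        apply one_le_exp
        have : |κ * t| = |κ| * t := by rw [abs_mul, abs_of_nonneg ht]
        have h5 : |κ| * t ≤ |κ| * 1 := mul_le_mul_of_nonneg_left h (abs_nonneg _)
        linarith [le_abs_self (κ * t)]
      have e5 : K * exp 1 * 1 ≤ K * exp 1 * (exp |κ| * exp (-κ * t)) :=
        mul_le_mul_of_nonneg_left e4 (by positivity)
      linarith
    · rcases le_total r R with h' | h'
      · have e1 := h7 r hr h' t h
        linarith
      · have e1 := h3 r hr t ht
        have e2 : r ^ (-γ) ≤ R ^ (-γ) := rpow_le_rpow_of_nonpos hR h' (by linarith)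
        have e3 : M * exp (-κ * t) * r ^ (-γ) ≤ M * exp (-κ * t) * R ^ (-γ) :=
          mul_le_mul_of_nonneg_left e2 (by positivity)
        have e4 := mul_le_mul_of_nonneg_right hNM hE.le
        linarith
  intro r hr t ht
  rcases (show (0:ℝ) ≤ r from hr).lt_or_eq with h | h
  · exact hpos r h t ht
  · rw [← h]
    have hvc : ContinuousOn (fun r => v r t) (Ici 0) := by
      have : ContinuousOn (fun r : ℝ => ((r, t) : ℝ × ℝ)) (Ici 0) := by fun_prop
      exact hv.cont.comp this (fun x hx => ⟨hx, ht⟩)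
    have hc : ContinuousOn (fun r => |v r t - φ r|) (Ici 0) := (hvc.sub hφc).abs
    have h1 : Tendsto (fun r => |v r t - φ r|) (nhdsWithin 0 (Ioi 0)) (nhds |v 0 t - φ 0|) :=
      (hc 0 self_mem_Ici).mono_left (nhdsWithin_mono _ Ioi_subset_Ici_self)
    apply le_of_tendsto h1
    filter_upwards [self_mem_nhdsWithin] with x hx using hpos x hx t ht

/-- Lemma 3.4: under the hypotheses of Lemma 3.2, there is `C > 0` such
that every bounded classical radial solution `v` with initial data `v₀` satisfies
`|v(r,t) − φ_α(r)| ≤ C e^{−κ(γ)t}` for all `r ≥ 0`, `t ≥ 0`. -/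
theorem radial_rate_from_above (n : ℕ) (hn : 10 < n) (p α b γ : ℝ)
    (hp : pc n < p) (hα : 0 < α) (hb : 0 < b)
    (hγ : γ ∈ Set.Ioo (nuExp p + lam1 n p) (((n : ℝ) - 2) / 2))
    (φ : ℝ → ℝ) (a : ℝ) (hφ : IsSteadyStateA n p α φ a)
    (v₀ : ℝ → ℝ) (hv₀cont : ContinuousOn v₀ (Set.Ici 0))
    (hv₀nonneg : ∀ r > (0 : ℝ), 0 ≤ v₀ r)
    (hv₀upper : ∀ r > (0 : ℝ), v₀ r ≤ Lconst n p * r ^ (-nuExp p))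
    (hv₀ge : ∀ r ≥ (0 : ℝ), φ r ≤ v₀ r)
    (hv₀close : ∀ r > (1 : ℝ), v₀ r ≤ φ r + b * r ^ (-γ)) :
    ∃ C > 0, ∀ v : ℝ → ℝ → ℝ, IsRadialSol n p v v₀ →
      ∀ r ≥ (0 : ℝ), ∀ t ≥ (0 : ℝ),
        |v r t - φ r| ≤ C * Real.exp (-(kappaOf n p γ) * t) := by
  have P := rr_par n hn p hp
  have hl := rr_lam1_pos P
  have hn' := P.hn
  have hanti : ∀ r > (0:ℝ), ∀ s ≥ r, φ s ≤ φ r := fun r hr s hs =>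
    hφ.anti.antitoneOn (show (0:ℝ) ≤ r from hr.le)
      (show (0:ℝ) ≤ s from (show (0:ℝ) ≤ r from hr.le).trans hs) hs
  have hφα : ∀ r > (0:ℝ), φ r ≤ α := by
    intro r hr
    rw [← hφ.val0]
    exact hφ.anti.antitoneOn (show (0:ℝ) ≤ 0 from le_rfl) (show (0:ℝ) ≤ r from hr.le) hr.le
  refine rr_final P α b γ (kappaOf n p γ) (lam1 n p) a hb hl hγ.1 (by linarith [hγ.2]) ?_
    hφ.a_pos (rr_steady hφ) hφ.cont hanti hφα hφ.upper hφ.expansion v₀ hv₀cont hv₀upper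
    hv₀ge hv₀close
  have h1 : 0 < p * Lconst n p ^ (p - 1) :=
    mul_pos (by linarith [P.hp]) (rpow_pos_of_pos P.L_pos _)
  unfold kappaOf
  rw [add_sub_cancel, div_mul_cancel₀ _ h1.ne']
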